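/- arXiv:2105.02278 — 7 statements merged into one kernel-verified Lean document; each statement's English description precedes it below -/
import Mathlib

section
/- Let 𝒯 be a non-trivial hereditary property of binary matroids. Then the following are equivalent: (a) 𝒯 is thin, i.e. χ_c(𝒯) = 0; (b) there exists an affine pattern A such that every matroid in 𝒯 is A-free; (c) h(n,𝒯) = o(2ⁿ) as n → ∞. -/
open Function Filter Asymptotics

/-- The vector space 𝔽₂ⁿ. The binary projective space of dimension `n` is
`𝔽₂ⁿ ∖ {0}`. -/
abbrev F2 (n : ℕ) : Type := Fin n → ZMod 2

/-- A simple binary matroid of dimension `n`: a function `𝔽₂ⁿ ∖ {0} → {0,1}`,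
encoded as a function on all of `𝔽₂ⁿ` whose value at `0` is fixed to `false`. -/
structure BinMatroid where
  dim : ℕ
  val : F2 dim → Bool
  val0 : val 0 = false

/-- `IsRestriction N M` : there is an `N`-instance in `M`, i.e. an injective linear map
`φ : 𝔽₂^{dim N} → 𝔽₂^{dim M}` with `N x = M (φ x)` for all nonzero `x`;
equivalently, `N` is isomorphic to the restriction of `M` to the subspace `range φ`. -/
def IsRestriction (N M : BinMatroid) : Prop :=
  ∃ φ : F2 N.dim →ₗ[ZMod 2] F2 M.dim, Injective φ ∧
    ∀ x : F2 N.dim, x ≠ 0 → N.val x = M.val (φ x)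

/-- A hereditary matroid property: closed under isomorphism and under restriction
to linear subspaces (equivalently, closed under `IsRestriction`). -/
def IsHereditary (P : Set BinMatroid) : Prop :=
  ∀ M ∈ P, ∀ N : BinMatroid, IsRestriction N M → N ∈ P

/-- A matroid property is non-trivial if it contains matroids of arbitrarily high dimension. -/
def NonTrivial (P : Set BinMatroid) : Prop :=
  ∀ n : ℕ, ∃ M ∈ P, n ≤ M.dim

/-- `Pⁿ` : the matroids of dimension `n` in `P`. -/
def sect (P : Set BinMatroid) (n : ℕ) : Set BinMatroid :=
  {M | M ∈ P ∧ M.dim = n}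

/-- The entropy `h(n, P) = log₂ |Pⁿ|`. -/
noncomputable def entropy (P : Set BinMatroid) (n : ℕ) : ℝ :=
  Real.logb 2 ((sect P n).ncard : ℝ)

/-- `ℳ(k, b)` : matroids `M` with `M[W] ≡ b` for some subspace `W` of codimension
at most `k` (given as the range of an injective linear map `φ` from `𝔽₂^m`,
where `dim M ≤ m + k`). -/
def MkOne (k : ℕ) (b : Bool) : Set BinMatroid :=
  {M | ∃ (m : ℕ) (φ : F2 m →ₗ[ZMod 2] F2 M.dim),
    M.dim ≤ m + k ∧ Injective φ ∧ ∀ x : F2 m, x ≠ 0 → M.val (φ x) = b}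

/-- `χ_c(P) = k` : `k` is the maximum integer such that `ℳ(k, i) ⊆ P` for some
`i ∈ {0,1}`. -/
def HasCritNum (P : Set BinMatroid) (k : ℕ) : Prop :=
  (MkOne k false ⊆ P ∨ MkOne k true ⊆ P) ∧
  ∀ j : ℕ, (MkOne j false ⊆ P ∨ MkOne j true ⊆ P) → j ≤ k

/-- `Ext^k(M)` : matroids `M'` with `dim M' ≤ k + dim M` such that `M` is the restriction
of `M'` to a subspace of codimension at most `k`. -/
def ExtK (k : ℕ) (M : BinMatroid) : Set BinMatroid :=
  {M' | M'.dim ≤ k + M.dim ∧ IsRestriction M M'}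

/-- `Ext^k(P) = ⋃_{M ∈ P} Ext^k(M)`. -/
def ExtKP (k : ℕ) (P : Set BinMatroid) : Set BinMatroid :=
  ⋃ M ∈ P, ExtK k M

/-- Almost every matroid in `P` lies in `Q`:
`lim_{n → ∞} |Pⁿ ∩ Q| / |Pⁿ| = 1`. -/
def AlmostAll (P Q : Set BinMatroid) : Prop :=
  Tendsto (fun n : ℕ => ((sect (P ∩ Q) n).ncard : ℝ) / ((sect P n).ncard : ℝ))
    atTop (nhds 1)

/-- A pattern: a function `𝔽₂ⁿ ∖ {0} → {0, 1, ⋆}`, where `⋆` is encoded by `none`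
(and the irrelevant value at `0` is fixed to `none`). -/
structure BinPattern where
  dim : ℕ
  val : F2 dim → Option Bool
  val0 : val 0 = none

/-- An `A`-instance in a matroid `M`, for a pattern `A`: an injective linear map `φ`
with `A x = M (φ x)` whenever `A x ∈ {0,1}`. -/
def PatInstance (A : BinPattern) (M : BinMatroid) : Prop :=
  ∃ φ : F2 A.dim →ₗ[ZMod 2] F2 M.dim, Injective φ ∧
    ∀ (x : F2 A.dim) (b : Bool), A.val x = some b → M.val (φ x) = b

/-- `M` is `A`-free: there is no `A`-instance in `M`. -/
def PatFree (A : BinPattern) (M : BinMatroid) : Prop := ¬ PatInstance A M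

/-- A pattern `A` is `k`-affine if `A⁻¹(⋆)` is a subspace of codimension `k`. -/
def IsKAffine (k : ℕ) (A : BinPattern) : Prop :=
  ∃ W : Submodule (ZMod 2) (F2 A.dim),
    Module.finrank (ZMod 2) W + k = A.dim ∧
    ∀ x : F2 A.dim, A.val x = none ↔ x ∈ W

/-- `Forb(𝒩)` : matroids that are `N`-free for every `N ∈ 𝒩`. -/
def Forb (𝒩 : Set BinMatroid) : Set BinMatroid :=
  {M | ∀ N ∈ 𝒩, ¬ IsRestriction N M}

/-- A locally characterized hereditary matroid property: `P = Forb(𝒩)` for a finite `𝒩`. -/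
def LocallyCharacterized (P : Set BinMatroid) : Prop :=
  ∃ 𝒩 : Set BinMatroid, 𝒩.Finite ∧ P = Forb 𝒩

/-- `Core^k(P) = {M | Ext^k(M) ⊆ P}`. -/
def CoreK (k : ℕ) (P : Set BinMatroid) : Set BinMatroid :=
  {M | ExtK k M ⊆ P}

theorem zmod_two_eq_one {a : ZMod 2} (h : a ≠ 0) : a = 1 := by
  revert h; revert a; decide

/-- A subspace of codimension at most one contains the kernel of a linear functional. -/
theorem exists_functional_ker_le {V : Type} [AddCommGroup V] [Module (ZMod 2) V]
    [FiniteDimensional (ZMod 2) V] (W : Submodule (ZMod 2) V)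
    (h : Module.finrank (ZMod 2) V ≤ Module.finrank (ZMod 2) W + 1) :
    ∃ l : V →ₗ[ZMod 2] ZMod 2, ∀ x, l x = 0 → x ∈ W := by
  have hq := W.finrank_quotient_add_finrank
  have h1 : Module.finrank (ZMod 2) (V ⧸ W) ≤ Module.finrank (ZMod 2) (ZMod 2) := by
    rw [Module.finrank_self]; omega
  obtain ⟨f, hf⟩ : ∃ f : (V ⧸ W) →ₗ[ZMod 2] ZMod 2, Injective f :=
    finrank_le_iff_exists_linearMap.1 h1
  refine ⟨f ∘ₗ W.mkQ, fun x hx => ?_⟩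
  have : f (W.mkQ x) = f 0 := by simpa using hx
  simpa using hf this

/-- Dense subsets of `𝔽₂ⁿ` contain affine flats of any fixed dimension. -/
theorem exists_flat_of_dense (k : ℕ) : ∀ ε : ℝ, 0 < ε → ∃ N : ℕ, ∀ n ≥ N, ∀ S : Finset (F2 n),
    ε * 2 ^ n ≤ (S.card : ℝ) →
      ∃ (x : F2 n) (φ : F2 k →ₗ[ZMod 2] F2 n), Injective φ ∧ ∀ u, x + φ u ∈ S := by
  classical
  induction k with
  | zero =>
    intro ε hε
    refine ⟨0, fun n _ S hS => ?_⟩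
    have hpos : (0 : ℝ) < S.card := lt_of_lt_of_le (by positivity) hS
    obtain ⟨x, hx⟩ := Finset.card_pos.1 (by exact_mod_cast hpos)
    exact ⟨x, 0, injective_of_subsingleton _, fun u => by simpa using hx⟩
  | succ k ih =>
    intro ε hε
    obtain ⟨m, hm⟩ := ih (ε / 2) (by positivity)
    have : Finite (F2 k →ₗ[ZMod 2] F2 m) := Module.finite_of_finite (ZMod 2)
    have : Fintype (F2 k →ₗ[ZMod 2] F2 m) := Fintype.ofFinite _
    set K := Fintype.card (F2 m × (F2 k →ₗ[ZMod 2] F2 m)) with hK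
    obtain ⟨r₀, hr₀⟩ := pow_unbounded_of_one_lt ((K : ℝ) / (ε / 2)) (one_lt_two (α := ℝ))
    refine ⟨m + r₀, fun n hn S hS => ?_⟩
    obtain ⟨r, rfl⟩ : ∃ r, n = m + r := ⟨n - m, by omega⟩
    have hr : (K : ℝ) < ε / 2 * 2 ^ r := by
      rw [div_lt_iff₀ (by positivity)] at hr₀
      have : (2 : ℝ) ^ r₀ ≤ 2 ^ r := pow_le_pow_right₀ (by norm_num) (by omega)
      nlinarith
    let e : (F2 m × F2 r) ≃ₗ[ZMod 2] F2 (m + r) := LinearEquiv.ofFinrankEq _ _ (by simp)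
    let fib : F2 r → Finset (F2 m) := fun a => Finset.univ.filter fun y => e (y, a) ∈ S
    let G : Finset (F2 r) := Finset.univ.filter fun a => ε / 2 * 2 ^ m ≤ ((fib a).card : ℝ)
    have hsum : (S.card : ℝ) = ∑ a : F2 r, ((fib a).card : ℝ) := by
      have h1 : S.card = (Finset.univ.filter fun p : F2 m × F2 r => e p ∈ S).card := by
        symm
        refine Finset.card_bij (fun p _ => e p) (by simp) (fun a _ b _ h => e.injective h) ?_
        intro b hb
        exact ⟨e.symm b, by simpa using hb, by simp⟩
      rw [h1, Finset.card_filter, ← Nat.cast_sum]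
      congr 1
      rw [Fintype.sum_prod_type_right]
      exact Finset.sum_congr rfl fun a _ => (Finset.card_filter _ _).symm
    have hG : ε / 2 * 2 ^ r ≤ (G.card : ℝ) := by
      have hle : ∀ a : F2 r, ((fib a).card : ℝ) ≤
          (if a ∈ G then (2 : ℝ) ^ m else 0) + ε / 2 * 2 ^ m := by
        intro a
        by_cases ha : a ∈ G
        · rw [if_pos ha]
          have : (fib a).card ≤ 2 ^ m := by
            simpa [ZMod.card] using (Finset.card_le_univ (fib a))
          have : ((fib a).card : ℝ) ≤ 2 ^ m := by exact_mod_cast this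
          have : 0 ≤ ε / 2 * 2 ^ m := by positivity
          linarith
        · rw [if_neg ha, zero_add]
          simp only [G, Finset.mem_filter, Finset.mem_univ, true_and, not_le] at ha
          exact ha.le
      have h2 : (S.card : ℝ) ≤ G.card * 2 ^ m + 2 ^ r * (ε / 2 * 2 ^ m) := by
        rw [hsum]
        refine (Finset.sum_le_sum fun a _ => hle a).trans (le_of_eq ?_)
        rw [Finset.sum_add_distrib]
        simp [ZMod.card]
      have h3 : (0 : ℝ) < 2 ^ m := by positivity
      rw [pow_add] at hS
      nlinarith
    have hflat : ∀ a ∈ G, ∃ p : F2 m × (F2 k →ₗ[ZMod 2] F2 m),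
        Injective p.2 ∧ ∀ u, e (p.1 + p.2 u, a) ∈ S := by
      intro a ha
      obtain ⟨x, φ, hφ, hx⟩ := hm m le_rfl (fib a) (by simpa [G] using ha)
      exact ⟨(x, φ), hφ, fun u => by simpa [fib] using hx u⟩
    choose! p hp using hflat
    have hcard : (Finset.univ : Finset (F2 m × (F2 k →ₗ[ZMod 2] F2 m))).card < G.card := by
      have : (K : ℝ) < G.card := hr.trans_le hG
      rw [Finset.card_univ]
      exact_mod_cast this
    obtain ⟨a, ha, b, hb, hab, hpab⟩ := Finset.exists_ne_map_eq_of_card_lt_of_maps_to hcard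
      (f := p) (fun _ _ => Finset.mem_coe.2 (Finset.mem_univ _))
    let ψ : F2 (k + 1) →ₗ[ZMod 2] F2 m × F2 r :=
      ((p a).2 ∘ₗ LinearMap.funLeft (ZMod 2) (ZMod 2) Fin.succ).prod
        ((LinearMap.proj 0).smulRight (b - a))
    have hψ : ∀ u, ψ u = ((p a).2 (fun i => u i.succ), u 0 • (b - a)) := fun u => rfl
    refine ⟨e ((p a).1, a), e.toLinearMap ∘ₗ ψ, ?_, fun u => ?_⟩
    · refine e.injective.comp ((injective_iff_map_eq_zero ψ).2 fun u hu => ?_)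
      rw [hψ, Prod.mk_eq_zero] at hu
      have h0 : u 0 = 0 := (smul_eq_zero.1 hu.2).resolve_right (sub_ne_zero.2 hab.symm)
      have ht := (injective_iff_map_eq_zero _).1 (hp a ha).1 _ hu.1
      funext i
      refine Fin.cases h0 (fun j => ?_) i
      exact congrFun ht j
    · rw [LinearMap.comp_apply, LinearEquiv.coe_coe, ← map_add, hψ, Prod.mk_add_mk]
      by_cases h0 : u 0 = 0
      · rw [h0, zero_smul, add_zero]
        exact (hp a ha).2 _
      · rw [zmod_two_eq_one h0, one_smul, add_sub_cancel, hpab]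
        exact (hp b hb).2 _

/-- Ramsey's theorem for the points of binary projective spaces. -/
theorem exists_mono_subspace (s : ℕ) : ∀ d : Bool → ℕ, d false + d true = s →
    ∃ N : ℕ, ∀ n ≥ N, ∀ c : F2 n → Bool, ∃ (b : Bool) (φ : F2 (d b) →ₗ[ZMod 2] F2 n),
      Injective φ ∧ ∀ x, x ≠ 0 → c (φ x) = b := by
  classical
  induction s with
  | zero =>
    intro d hd
    refine ⟨0, fun n _ c => ⟨true, 0, ?_, fun x hx => ?_⟩⟩
    all_goals
      have h0 : d true = 0 := by omega
      have : IsEmpty (Fin (d true)) := by rw [h0]; infer_instance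
    · exact injective_of_subsingleton _
    · exact absurd (Subsingleton.elim x 0) hx
  | succ s ih =>
    intro d hd
    by_cases hz : ∃ b, d b = 0
    · obtain ⟨b, hb⟩ := hz
      have : IsEmpty (Fin (d b)) := by rw [hb]; infer_instance
      exact ⟨0, fun n _ c => ⟨b, 0, injective_of_subsingleton _,
        fun x hx => absurd (Subsingleton.elim x 0) hx⟩⟩
    push Not at hz
    have step : ∀ b, ∃ N : ℕ, ∀ n ≥ N, ∀ c : F2 n → Bool,
        ∃ (b' : Bool) (k : ℕ) (φ : F2 k →ₗ[ZMod 2] F2 n),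
          k = Function.update d b (d b - 1) b' ∧
          Injective φ ∧ ∀ x, x ≠ 0 → c (φ x) = b' := by
      intro b
      obtain ⟨N, hN⟩ := ih (Function.update d b (d b - 1)) (by
        have h1 := hz true
        have h2 := hz false
        cases b <;> simp <;> omega)
      refine ⟨N, fun n hn c => ?_⟩
      obtain ⟨b', φ, h⟩ := hN n hn c
      exact ⟨b', _, φ, rfl, h⟩
    choose R hR using step
    obtain ⟨N, hN⟩ := exists_flat_of_dense (max (R false) (R true)) (1 / 2) (by norm_num)
    refine ⟨N + 1, fun n' hn' c => ?_⟩
    obtain ⟨n, rfl⟩ : ∃ n, n' = n + 1 := ⟨n' - 1, by omega⟩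
    let ι : F2 n →ₗ[ZMod 2] F2 (n + 1) :=
      LinearMap.pi (Fin.cons 0 fun i => LinearMap.proj i)
    have hι0 : ∀ y, ι y 0 = 0 := fun y => rfl
    have hιs : ∀ y i, ι y (Fin.succ i) = y i := fun y i => rfl
    have hι : Injective ι := fun y z h => funext fun i => by
      rw [← hιs y i, ← hιs z i, h]
    let o : F2 (n + 1) := Pi.single 0 1
    let S : Bool → Finset (F2 n) := fun b => Finset.univ.filter fun y => c (o + ι y) = b
    have hS : (S false).card + (S true).card = 2 ^ n := by
      have := Finset.card_filter_add_card_filter_not (s := (Finset.univ : Finset (F2 n)))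
        (fun y => c (o + ι y) = false)
      simpa [S, ZMod.card] using this
    obtain ⟨b, hb⟩ : ∃ b, (1 / 2 : ℝ) * 2 ^ n ≤ (S b).card := by
      by_contra! h
      have h1 := h false
      have h2 := h true
      have h3 : ((S false).card : ℝ) + (S true).card = 2 ^ n := by exact_mod_cast hS
      linarith
    obtain ⟨x, ψ, hψ, hx⟩ := hN n (by omega) (S b) hb
    obtain ⟨b', k, φ, hk, hφ, hmono⟩ := hR b (max (R false) (R true))
      (by cases b <;> simp) (fun u => c (ι (ψ u)))
    by_cases hbb : b' = b
    · subst hbb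
      rw [Function.update_self] at hk
      let χ : F2 (k + 1) →ₗ[ZMod 2] F2 (n + 1) :=
        (LinearMap.proj 0).smulRight (o + ι x) +
          ι ∘ₗ ψ ∘ₗ φ ∘ₗ LinearMap.funLeft (ZMod 2) (ZMod 2) Fin.succ
      have hχ : ∀ u, χ u = u 0 • (o + ι x) + ι (ψ (φ fun i => u i.succ)) := fun u => rfl
      have key : ∃ χ : F2 (k + 1) →ₗ[ZMod 2] F2 (n + 1),
          Injective χ ∧ ∀ u, u ≠ 0 → c (χ u) = b' := by
        refine ⟨χ, (injective_iff_map_eq_zero χ).2 fun u hu => ?_, fun u hu => ?_⟩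
        · rw [hχ] at hu
          have h0 : u 0 = 0 := by simpa [hι0, o] using congrFun hu 0
          rw [h0, zero_smul, zero_add] at hu
          have ht := (injective_iff_map_eq_zero (ι ∘ₗ ψ ∘ₗ φ)).1
            (hι.comp (hψ.comp hφ)) _ hu
          funext i
          exact Fin.cases h0 (fun j => congrFun ht j) i
        · rw [hχ]
          by_cases h0 : u 0 = 0
          · rw [h0, zero_smul, zero_add]
            refine hmono _ fun ht => hu (funext fun i => ?_)
            exact Fin.cases h0 (fun j => congrFun ht j) i
          · rw [zmod_two_eq_one h0, one_smul, add_assoc, ← map_add]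
            exact (Finset.mem_filter.1 (hx _)).2
      have hk' : k + 1 = d b' := by have := hz b'; omega
      rw [hk'] at key
      exact ⟨b', key⟩
    · rw [Function.update_of_ne hbb] at hk
      subst hk
      exact ⟨b', ι ∘ₗ ψ ∘ₗ φ, hι.comp (hψ.comp hφ), hmono⟩

/-- A non-trivial hereditary property contains all constant matroids of one value. -/
theorem mkOne_zero_subset {P : Set BinMatroid} (hher : IsHereditary P) (hnt : NonTrivial P) :
    MkOne 0 false ⊆ P ∨ MkOne 0 true ⊆ P := by
  suffices ∃ b, MkOne 0 b ⊆ P by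
    obtain ⟨b, hb⟩ := this
    cases b
    exacts [Or.inl hb, Or.inr hb]
  by_contra! h
  have h' : ∀ b, ∃ M ∈ MkOne 0 b, M ∉ P := fun b => Set.not_subset.1 (h b)
  choose M hM hMP using h'
  obtain ⟨N, hN⟩ := exists_mono_subspace _ (fun b => (M b).dim) rfl
  obtain ⟨L, hL, hNL⟩ := hnt N
  obtain ⟨b, φ, hφ, hmono⟩ := hN _ hNL L.val
  refine hMP b (hher L hL _ ⟨φ, hφ, fun x hx => ?_⟩)
  rw [hmono x hx]
  obtain ⟨m, θ, hm, hθ, hc⟩ := hM b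
  have hfin : m = (M b).dim := by
    have := LinearMap.finrank_le_finrank_of_injective hθ
    simp at this
    omega
  have hsurj : Surjective θ :=
    (LinearMap.injective_iff_surjective_of_finrank_eq_finrank (by simpa using hfin)).1 hθ
  obtain ⟨y, rfl⟩ := hsurj x
  exact hc y (by rintro rfl; simp at hx)

theorem mkOne_mono {j k : ℕ} (h : j ≤ k) (b : Bool) : MkOne j b ⊆ MkOne k b := by
  rintro M ⟨m, φ, hm, hφ⟩
  exact ⟨m, φ, by omega, hφ⟩

/-- A non-trivial hereditary property is thin iff it contains neither `ℳ(1, 0)` nor `ℳ(1, 1)`. -/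
theorem hasCritNum_zero_iff {P : Set BinMatroid} (hher : IsHereditary P) (hnt : NonTrivial P) :
    HasCritNum P 0 ↔ ∀ b, ¬ MkOne 1 b ⊆ P := by
  constructor
  · rintro ⟨-, h⟩ b hb
    have := h 1 (by cases b; exacts [Or.inl hb, Or.inr hb])
    omega
  · refine fun h => ⟨mkOne_zero_subset hher hnt, fun j hj => ?_⟩
    by_contra! hlt
    rcases hj with hj | hj
    exacts [h _ ((mkOne_mono hlt _).trans hj), h _ ((mkOne_mono hlt _).trans hj)]

theorem exists_functional_of_mem_mkOne {M : BinMatroid} {b : Bool} (hM : M ∈ MkOne 1 b) :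
    ∃ l : F2 M.dim →ₗ[ZMod 2] ZMod 2, ∀ x, x ≠ 0 → l x = 0 → M.val x = b := by
  obtain ⟨m, φ, hm, hφ, hc⟩ := hM
  obtain ⟨l, hl⟩ := exists_functional_ker_le (LinearMap.range φ) (by
    rw [LinearMap.finrank_range_of_inj hφ]; simpa using hm)
  refine ⟨l, fun x hx hlx => ?_⟩
  obtain ⟨y, rfl⟩ := hl x hlx
  exact hc y (by rintro rfl; simp at hx)

/-- An affine pattern that is avoided by every hereditary property containing
neither `ℳ(1, 0)` nor `ℳ(1, 1)`. -/
theorem exists_affine_pattern {P : Set BinMatroid} (hher : IsHereditary P)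
    (h : ∀ b, ¬ MkOne 1 b ⊆ P) :
    ∃ A : BinPattern, IsKAffine 1 A ∧ ∀ M ∈ P, PatFree A M := by
  have h' : ∀ b, ∃ M ∈ MkOne 1 b, M ∉ P := fun b => Set.not_subset.1 (h b)
  choose M hM hMP using h'
  obtain ⟨N, hN⟩ := exists_mono_subspace _ (fun b => (M b).dim) rfl
  let V := ZMod 2 × F2 N × (F2 N → ZMod 2)
  let n := Module.finrank (ZMod 2) V
  let e : F2 n ≃ₗ[ZMod 2] V := LinearEquiv.ofFinrankEq _ _ (by simp [n])
  let A : BinPattern :=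
    { dim := n
      val := fun v => if (e v).1 = 0 then none else some (decide ((e v).2.2 (e v).2.1 = 1))
      val0 := by simp }
  let f : F2 n →ₗ[ZMod 2] ZMod 2 := LinearMap.fst (ZMod 2) _ _ ∘ₗ e.toLinearMap
  have hsurj : Surjective f := Prod.fst_surjective.comp e.surjective
  refine ⟨A, ⟨LinearMap.ker f, ?_, fun x => ?_⟩, ?_⟩
  · have := LinearMap.finrank_range_add_finrank_ker f
    rw [LinearMap.range_eq_top.2 hsurj, finrank_top, Module.finrank_self,
      Module.finrank_fin_fun] at this
    change _ + 1 = n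
    rw [add_comm]
    exact this
  · simp [A, f]
  · rintro L hL ⟨ψ, hψ, hA⟩
    obtain ⟨b, φ, hφ, hmono⟩ := hN N le_rfl fun w => L.val (ψ (e.symm (0, w, 0)))
    obtain ⟨l, hl⟩ := exists_functional_of_mem_mkOne (hM b)
    let p : F2 N → ZMod 2 := Function.extend φ (fun u => if (M b).val u then 1 else 0) 0
    let θ : F2 (M b).dim →ₗ[ZMod 2] V := l.prod (φ.prod (l.smulRight p))
    have hθ : ∀ u, θ u = (l u, φ u, l u • p) := fun u => rfl
    refine hMP b (hher L hL _ ⟨ψ ∘ₗ e.symm.toLinearMap ∘ₗ θ, ?_, fun u hu => ?_⟩)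
    · refine hψ.comp (e.symm.injective.comp fun u v huv => hφ ?_)
      rw [hθ, hθ] at huv
      exact congrArg (fun q => q.2.1) huv
    · change _ = L.val (ψ (e.symm (θ u)))
      rw [hθ]
      by_cases h0 : l u = 0
      · rw [h0, zero_smul, hl u hu h0]
        exact (hmono u hu).symm
      · symm
        apply hA
        rw [zmod_two_eq_one h0]
        simp [A, p, hφ.extend_apply]

/-- A property all of whose members avoid an affine pattern contains no `ℳ(1, b)`. -/
theorem not_mkOne_one_subset {P : Set BinMatroid} {A : BinPattern} (hA : IsKAffine 1 A)
    (hfree : ∀ M ∈ P, PatFree A M) (b : Bool) : ¬ MkOne 1 b ⊆ P := by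
  intro hsub
  obtain ⟨W, hW, hnone⟩ := hA
  let M : BinMatroid :=
    { dim := A.dim
      val := fun x => if x = 0 then false else (A.val x).getD b
      val0 := by simp }
  let e : F2 (Module.finrank (ZMod 2) W) ≃ₗ[ZMod 2] W := LinearEquiv.ofFinrankEq _ _ (by simp)
  have hinj : Injective (W.subtype ∘ₗ e.toLinearMap) := W.subtype_injective.comp e.injective
  refine hfree M (hsub ⟨_, W.subtype ∘ₗ e.toLinearMap, hW.ge, hinj, fun x hx => ?_⟩)
    ⟨LinearMap.id, injective_id, fun x b' hx => ?_⟩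
  · have h0 : (e x : F2 A.dim) ≠ 0 := by simpa using hx
    change (if (e x : F2 A.dim) = 0 then false else (A.val (e x)).getD b) = b
    rw [if_neg h0, (hnone _).2 (e x).2, Option.getD_none]
  · have h0 : x ≠ 0 := by
      rintro rfl
      simp [A.val0] at hx
    change (if x = 0 then false else (A.val x).getD b) = b'
    rw [if_neg h0, hx, Option.getD_some]

open Classical in
/-- The matroid of dimension `n` whose support is `s ∖ {0}`. -/
noncomputable def BinMatroid.ofFinset {n : ℕ} (s : Finset (F2 n)) : BinMatroid where
  dim := n
  val := fun x => decide (x ∈ s ∧ x ≠ 0)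
  val0 := by simp

theorem BinMatroid.ofFinset_val {n : ℕ} (s : Finset (F2 n)) (x : F2 n) :
    (BinMatroid.ofFinset s).val x = true ↔ x ∈ s ∧ x ≠ 0 := by
  classical
  exact decide_eq_true_iff

open Classical in
/-- The supports of the `n`-dimensional matroids of a property. -/
noncomputable def supports (P : Set BinMatroid) (n : ℕ) : Finset (Finset (F2 n)) :=
  Finset.univ.filter fun s => (0 : F2 n) ∉ s ∧ BinMatroid.ofFinset s ∈ P

theorem sect_subset (P : Set BinMatroid) (n : ℕ) :
    sect P n ⊆ BinMatroid.ofFinset '' (supports P n : Set (Finset (F2 n))) := by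
  classical
  rintro ⟨m, v, h0⟩ ⟨hP, rfl⟩
  have heq : BinMatroid.ofFinset (Finset.univ.filter fun x => v x = true) = ⟨m, v, h0⟩ := by
    simp only [BinMatroid.ofFinset, BinMatroid.mk.injEq, heq_eq_eq, true_and]
    funext x
    by_cases hx : x = 0
    · subst hx; simp [h0]
    · simp [hx]
  exact ⟨_, by simp [supports, h0, heq, hP], heq⟩

theorem sect_finite (P : Set BinMatroid) (n : ℕ) : (sect P n).Finite :=
  ((Finset.finite_toSet _).image _).subset (sect_subset P n)

theorem ncard_sect_le (P : Set BinMatroid) (n : ℕ) : (sect P n).ncard ≤ (supports P n).card := by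
  refine (Set.ncard_le_ncard (sect_subset P n) ((Finset.finite_toSet _).image _)).trans ?_
  refine (Set.ncard_image_le (Finset.finite_toSet _)).trans ?_
  rw [Set.ncard_coe_finset]

/-- `ℳ(1, b)` has at least `2 ^ 2 ^ n` members of dimension `n + 1`. -/
theorem le_ncard_sect_of_mkOne_subset {P : Set BinMatroid} {b : Bool} (h : MkOne 1 b ⊆ P)
    (n : ℕ) : 2 ^ 2 ^ n ≤ (sect P (n + 1)).ncard := by
  let F : (F2 n → Bool) → BinMatroid := fun f =>
    { dim := n + 1
      val := fun x => if x = 0 then false else if x 0 = 0 then b else f fun i => x i.succ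
      val0 := by simp }
  have hF : Injective F := by
    intro f g hfg
    simp only [F, BinMatroid.mk.injEq, heq_eq_eq, true_and] at hfg
    funext y
    have h1 := congrFun hfg (Fin.cons 1 y)
    have h2 : (Fin.cons 1 y : F2 (n + 1)) ≠ 0 := fun h => by simpa using congrFun h 0
    simpa [h2] using h1
  have hmem : Set.range F ⊆ sect P (n + 1) := by
    rintro _ ⟨f, rfl⟩
    let ι : F2 n →ₗ[ZMod 2] F2 (n + 1) :=
      LinearMap.pi (Fin.cons 0 fun i => LinearMap.proj i)
    have hι0 : ∀ y, ι y 0 = 0 := fun y => rfl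
    have hιs : ∀ y i, ι y (Fin.succ i) = y i := fun y i => rfl
    have hι : Injective ι := fun y z h => funext fun i => by
      rw [← hιs y i, ← hιs z i, h]
    refine ⟨h ⟨n, ι, le_rfl, hι, fun x hx => ?_⟩, rfl⟩
    have h0 : ι x ≠ 0 := by rwa [Ne, map_eq_zero_iff _ hι]
    change (if ι x = 0 then false else if ι x 0 = 0 then b else _) = b
    rw [if_neg h0, if_pos (hι0 x)]
  have := Set.ncard_le_ncard hmem (sect_finite P _)
  rw [← Set.image_univ, Set.ncard_image_of_injective _ hF, Set.ncard_univ,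
    Nat.card_eq_fintype_card] at this
  simpa [ZMod.card] using this

/-- A family of small sets has small logarithmic size. -/
theorem logb_card_le_of_card_le {α : Type*} [Fintype α] (m : ℕ) {ε : ℝ} (hε : 0 ≤ ε)
    (𝒜 : Finset (Finset α)) (h𝒜 : ∀ s ∈ 𝒜, (s.card : ℝ) ≤ ε * Fintype.card α) :
    Real.logb 2 (𝒜.card) ≤ (2 * (1 / 2) ^ m + m * ε) * Fintype.card α := by
  set N := Fintype.card α with hN
  rcases 𝒜.eq_empty_or_nonempty with rfl | hne
  · simp only [Finset.card_empty, Nat.cast_zero, Real.logb_zero]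
    positivity
  set t : ℝ := (1 / 2) ^ m with ht
  have htpos : 0 < t := by positivity
  have hsum : ∑ s : Finset α, t ^ s.card = (1 + t) ^ N := by
    have := Finset.sum_pow_mul_eq_add_pow t 1 (Finset.univ : Finset α)
    simpa [add_comm] using this
  have h1 : (𝒜.card : ℝ) * (2 : ℝ) ^ (-(m * (ε * N)) : ℝ) ≤ (1 + t) ^ N := by
    rw [← hsum, ← nsmul_eq_mul]
    refine (Finset.card_nsmul_le_sum 𝒜 (fun s => t ^ s.card) _ fun s hs => ?_).trans
      (Finset.sum_le_sum_of_subset_of_nonneg (Finset.subset_univ _) fun _ _ _ => by positivity)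
    have : t ^ s.card = (2 : ℝ) ^ (-(m * (s.card : ℝ)) : ℝ) := by
      rw [ht, one_div, ← pow_mul, inv_pow, Real.rpow_neg (by norm_num), ← Nat.cast_mul,
        Real.rpow_natCast]
    rw [this]
    refine Real.rpow_le_rpow_of_exponent_le (by norm_num) (neg_le_neg ?_)
    exact mul_le_mul_of_nonneg_left (h𝒜 s hs) (by positivity)
  have hcpos : (0 : ℝ) < 𝒜.card := by exact_mod_cast hne.card_pos
  have h2 := Real.logb_le_logb_of_le (b := 2) (by norm_num) (by positivity) h1
  rw [Real.logb_mul hcpos.ne' (by positivity), Real.logb_rpow (by norm_num) (by norm_num),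
    Real.logb_pow] at h2
  have h3 : Real.logb 2 (1 + t) ≤ 2 * t := by
    rw [Real.logb, div_le_iff₀ (Real.log_pos (by norm_num))]
    have h4 := Real.log_le_sub_one_of_pos (show 0 < 1 + t by positivity)
    have h5 := Real.log_two_gt_d9
    nlinarith
  have h6 : (N : ℝ) * Real.logb 2 (1 + t) ≤ N * (2 * t) :=
    mul_le_mul_of_nonneg_left h3 (by positivity)
  linarith

/-- If the supports shatter a set containing a flat, some member contains the pattern. -/
theorem patInstance_of_shatters {P : Set BinMatroid} {A : BinPattern} (hA : IsKAffine 1 A)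
    {n : ℕ} [DecidableEq (F2 n)] {s : Finset (F2 n)} (hs : (supports P n).Shatters s)
    {x : F2 n} {φ : F2 A.dim →ₗ[ZMod 2] F2 n} (hφ : Injective φ) (hx : ∀ u, x + φ u ∈ s) :
    ∃ M ∈ P, PatInstance A M := by
  classical
  obtain ⟨W, hW, hnone⟩ := hA
  obtain ⟨l, hl⟩ := exists_functional_ker_le W (by rw [hW]; simp)
  have h0 : (0 : F2 n) ∉ s := by
    obtain ⟨u, hu, hsu⟩ := hs (Finset.Subset.refl s)
    intro h
    rw [← hsu] at h
    simp only [supports, Finset.mem_filter] at hu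
    exact hu.2.1 (Finset.mem_inter.1 h).2
  obtain ⟨u, hu, hsu⟩ := hs (Finset.filter_subset
    (fun y => ∃ v, A.val v = some true ∧ y = x + φ v) s)
  simp only [supports, Finset.mem_filter, Finset.mem_univ, true_and] at hu
  let ψ : F2 A.dim →ₗ[ZMod 2] F2 n := φ + l.smulRight x
  have hψ0 : ∀ v, l v = 0 → ψ v = φ v := fun v h => by simp [ψ, h]
  have hψ1 : ∀ v, l v ≠ 0 → ψ v = x + φ v := fun v h => by
    simp [ψ, zmod_two_eq_one h, add_comm]
  refine ⟨_, hu.2, ψ, (injective_iff_map_eq_zero ψ).2 fun v hv => ?_, fun v b hv => ?_⟩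
  · by_cases h : l v = 0
    · rw [hψ0 v h] at hv
      exact (injective_iff_map_eq_zero φ).1 hφ v hv
    · rw [hψ1 v h] at hv
      exact absurd (hv ▸ hx v) h0
  · have h : l v ≠ 0 := fun h => by
      have := (hnone v).2 (hl v h)
      rw [this] at hv
      cases hv
    have hmem : x + φ v ∈ u ↔ b = true := by
      have h1 : x + φ v ∈ s ∩ u ↔ x + φ v ∈ u := by simp [hx v]
      rw [← h1, hsu, Finset.mem_filter]
      constructor
      · rintro ⟨-, w, hw, hwv⟩
        rw [hφ (add_left_cancel hwv), hw] at hv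
        exact (Option.some.inj hv).symm
      · rintro rfl
        exact ⟨hx v, v, hv, rfl⟩
    have hne : x + φ v ≠ 0 := fun h => h0 (h ▸ hx v)
    refine Bool.eq_iff_iff.2 ((BinMatroid.ofFinset_val u (ψ v)).trans ?_)
    rw [hψ1 v h, hmem]
    exact and_iff_left hne

/-- Avoiding an affine pattern forces entropy `o(2ⁿ)`. -/
theorem entropy_isLittleO {P : Set BinMatroid} {A : BinPattern} (hA : IsKAffine 1 A)
    (hfree : ∀ M ∈ P, PatFree A M) :
    (fun n : ℕ => entropy P n) =o[atTop] (fun n : ℕ => (2 : ℝ) ^ n) := by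
  classical
  rw [isLittleO_iff]
  intro c hc
  obtain ⟨m, hm⟩ := exists_pow_lt_of_lt_one (show 0 < c / 4 by positivity)
    (show (1 / 2 : ℝ) < 1 by norm_num)
  set ε : ℝ := c / (2 * (m + 1)) with hε
  have hεpos : 0 < ε := by positivity
  have hmε : m * ε ≤ c / 2 := by
    rw [hε, mul_div_assoc', div_le_div_iff₀ (by positivity) (by norm_num)]
    nlinarith
  obtain ⟨N, hN⟩ := exists_flat_of_dense A.dim ε hεpos
  filter_upwards [eventually_ge_atTop N] with n hn
  have hcardF : (Fintype.card (F2 n) : ℝ) = 2 ^ n := by simp [ZMod.card]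
  rw [Real.norm_of_nonneg (by positivity : (0 : ℝ) ≤ 2 ^ n), Real.norm_of_nonneg]
  swap
  · rcases Nat.eq_zero_or_pos (sect P n).ncard with h | h
    · simp [entropy, h]
    · exact Real.logb_nonneg (by norm_num) (by exact_mod_cast h)
  rcases Nat.eq_zero_or_pos (sect P n).ncard with h | h
  · simp only [entropy, h, Nat.cast_zero, Real.logb_zero]
    positivity
  have hle : (sect P n).ncard ≤ (supports P n).shatterer.card :=
    (ncard_sect_le P n).trans (Finset.card_le_card_shatterer _)
  have hsmall : ∀ s ∈ (supports P n).shatterer, (s.card : ℝ) ≤ ε * Fintype.card (F2 n) := by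
    intro s hs
    rw [hcardF]
    by_contra! hlt
    obtain ⟨x, φ, hφ, hx⟩ := hN n hn s hlt.le
    obtain ⟨M, hM, hinst⟩ := patInstance_of_shatters hA (Finset.mem_shatterer.1 hs) hφ hx
    exact hfree M hM hinst
  have h1 : entropy P n ≤ Real.logb 2 ((supports P n).shatterer.card) :=
    Real.logb_le_logb_of_le (by norm_num) (by exact_mod_cast h) (by exact_mod_cast hle)
  have h2 := logb_card_le_of_card_le m hεpos.le _ hsmall
  rw [hcardF] at h2
  refine h1.trans (h2.trans (mul_le_mul_of_nonneg_right ?_ (by positivity)))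
  linarith

/-- Entropy `o(2ⁿ)` excludes `ℳ(1, b)`. -/
theorem not_mkOne_one_subset_of_isLittleO {P : Set BinMatroid}
    (h : (fun n : ℕ => entropy P n) =o[atTop] (fun n : ℕ => (2 : ℝ) ^ n)) (b : Bool) :
    ¬ MkOne 1 b ⊆ P := by
  intro hsub
  obtain ⟨N, hN⟩ := eventually_atTop.1 (isLittleO_iff.1 h (show (0 : ℝ) < 1 / 4 by norm_num))
  have h1 := (le_abs_self _).trans (hN (N + 1) (by omega))
  have h2 : Real.logb 2 ((2 : ℝ) ^ 2 ^ N) ≤ entropy P (N + 1) :=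
    Real.logb_le_logb_of_le (by norm_num) (by positivity)
      (by exact_mod_cast le_ncard_sect_of_mkOne_subset hsub N)
  rw [Real.logb_pow, Real.logb_self_eq_one (by norm_num)] at h2
  rw [Real.norm_of_nonneg (by positivity), pow_succ] at h1
  push_cast at h2
  have : (0 : ℝ) < 2 ^ N := by positivity
  linarith

/-- Theorem 1.3: for a non-trivial hereditary matroid property `𝒯`,
the following are equivalent: (a) `𝒯` is thin (`χ_c(𝒯) = 0`); (b) there is an affine
(i.e. 1-affine) pattern `A` such that every matroid in `𝒯` is `A`-free;
(c) `h(n, 𝒯) = o(2ⁿ)`. -/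
theorem thin_characterization (𝒯 : Set BinMatroid)
    (hher : IsHereditary 𝒯) (hnt : NonTrivial 𝒯) :
    (HasCritNum 𝒯 0 ↔ ∃ A : BinPattern, IsKAffine 1 A ∧ ∀ M ∈ 𝒯, PatFree A M) ∧
    (HasCritNum 𝒯 0 ↔
      (fun n : ℕ => entropy 𝒯 n) =o[atTop] (fun n : ℕ => (2 : ℝ) ^ n)) := by
  rw [hasCritNum_zero_iff hher hnt]
  refine ⟨⟨exists_affine_pattern hher, fun ⟨A, hA, hfree⟩ => not_mkOne_one_subset hA hfree⟩,
    fun h => ?_, not_mkOne_one_subset_of_isLittleO⟩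
  obtain ⟨A, hA, hfree⟩ := exists_affine_pattern hher h
  exact entropy_isLittleO hA hfree
end

section
/- Let 𝒯 be a non-trivial hereditary matroid property, and let k ≥ 0 and n ≥ k be integers. Then h(n−k,𝒯) + (1 − 2^{−k})·2ⁿ ≤ h(n, Ext^k(𝒯)) ≤ h(n−k,𝒯) + (1 − 2^{−k})·2ⁿ + kn. -/
open Function Filter Asymptotics

/-- The value functions of the matroids of dimension `n` in `P`. -/
def sectVals (P : Set BinMatroid) (n : ℕ) : Set (F2 n → Bool) :=
  {f | ∃ h : f 0 = false, (⟨n, f, h⟩ : BinMatroid) ∈ P}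

theorem ncard_sectVals (P : Set BinMatroid) (n : ℕ) :
    (sectVals P n).ncard = (sect P n).ncard := by
  refine Set.ncard_congr (fun f hf => ⟨n, f, hf.1⟩) ?_ ?_ ?_
  · rintro f ⟨h, hP⟩
    exact ⟨hP, rfl⟩
  · intro f g hf hg h
    simpa using h
  · rintro ⟨d, f, h⟩ ⟨hP, hd⟩
    obtain rfl : d = n := hd
    exact ⟨f, ⟨h, hP⟩, rfl⟩

theorem ncard_setOf_comp_mem {α β : Type*} [Fintype α] [Fintype β] {φ : α → β}
    (hφ : Injective φ) (S : Set (α → Bool)) :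
    {g : β → Bool | g ∘ φ ∈ S}.ncard = S.ncard * 2 ^ (Fintype.card β - Fintype.card α) := by
  classical
  let e : (β → Bool) ≃ (α → Bool) × ({b // b ∉ Set.range φ} → Bool) :=
    (Equiv.piEquivPiSubtypeProd (fun b => b ∈ Set.range φ) fun _ => Bool).trans
      (Equiv.prodCongr (Equiv.arrowCongr (Equiv.ofInjective φ hφ).symm (Equiv.refl Bool))
        (Equiv.refl _))
  have he : ∀ g, (e g).1 = g ∘ φ := fun g => rfl
  have hset : {g : β → Bool | g ∘ φ ∈ S} = e.symm '' (S ×ˢ Set.univ) := by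
    ext g
    simp [Equiv.image_symm_eq_preimage, he]
  rw [hset, Set.ncard_image_of_injective _ e.symm.injective, Set.ncard_prod, Set.ncard_univ]
  congr 1
  rw [Nat.card_eq_fintype_card, Fintype.card_fun, Fintype.card_bool, Fintype.card_subtype_compl]
  congr 2
  exact (Fintype.card_congr (Equiv.ofInjective φ hφ)).symm

theorem sectVals_comp {P : Set BinMatroid} (hP : IsHereditary P) {m d : ℕ}
    {ψ : F2 m →ₗ[ZMod 2] F2 d} (hψ : Injective ψ) {f : F2 d → Bool} (hf : f ∈ sectVals P d) :
    f ∘ ψ ∈ sectVals P m := by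
  obtain ⟨h, hM⟩ := hf
  exact ⟨by simpa using h, hP _ hM _ ⟨ψ, hψ, fun _ _ => rfl⟩⟩

theorem exists_injective_F2 {m n : ℕ} (h : m ≤ n) :
    ∃ φ : F2 m →ₗ[ZMod 2] F2 n, Injective φ :=
  finrank_le_iff_exists_linearMap.1 (by simpa using h)

theorem sectVals_nonempty {P : Set BinMatroid} (hP : IsHereditary P) (hnt : NonTrivial P) (m : ℕ) :
    (sectVals P m).Nonempty := by
  obtain ⟨M, hM, hm⟩ := hnt m
  obtain ⟨φ, hφ⟩ := exists_injective_F2 hm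
  exact ⟨_, sectVals_comp hP hφ (f := M.val) ⟨M.val0, hM⟩⟩

theorem mem_sectVals_extKP {P : Set BinMatroid} (hP : IsHereditary P) {k n : ℕ}
    (hkn : k ≤ n) (g : F2 n → Bool) :
    g ∈ sectVals (ExtKP k P) n ↔
      ∃ φ : F2 (n - k) →ₗ[ZMod 2] F2 n, Injective φ ∧ g ∘ φ ∈ sectVals P (n - k) := by
  constructor
  · rintro ⟨h, hg⟩
    simp only [ExtKP, ExtK, Set.mem_iUnion, Set.mem_ofPred_eq] at hg
    obtain ⟨M, hM, hd, ψ, hψ, hval⟩ := hg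
    obtain ⟨ι, hι⟩ := exists_injective_F2 (show n - k ≤ M.dim by omega)
    refine ⟨ψ ∘ₗ ι, hψ.comp hι, ?_⟩
    have hMψ : M.val = g ∘ ψ := by
      funext x
      by_cases hx : x = 0
      · subst hx
        simp [M.val0, h]
      · exact hval x hx
    have := sectVals_comp hP hι (f := M.val) ⟨M.val0, hM⟩
    rw [hMψ] at this
    exact this
  · rintro ⟨φ, hφ, h0, hM⟩
    refine ⟨by simpa using h0, ?_⟩
    simp only [ExtKP, ExtK, Set.mem_iUnion, Set.mem_ofPred_eq]
    exact ⟨_, hM, by dsimp only; omega, φ, hφ, fun _ _ => rfl⟩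

theorem exists_ker_eq_range {k n : ℕ} (hkn : k ≤ n) {φ : F2 (n - k) →ₗ[ZMod 2] F2 n}
    (hφ : Injective φ) :
    ∃ L : F2 n →ₗ[ZMod 2] F2 k, LinearMap.ker L = LinearMap.range φ := by
  have h1 := Submodule.finrank_quotient_add_finrank (LinearMap.range φ)
  rw [LinearMap.finrank_range_of_inj hφ, Module.finrank_fin_fun, Module.finrank_fin_fun] at h1
  have h2 : Module.finrank (ZMod 2) (F2 n ⧸ LinearMap.range φ) =
      Module.finrank (ZMod 2) (F2 k) := by
    rw [Module.finrank_fin_fun]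
    omega
  refine ⟨(LinearEquiv.ofFinrankEq _ _ h2).toLinearMap ∘ₗ (LinearMap.range φ).mkQ, ?_⟩
  rw [LinearEquiv.ker_comp, Submodule.ker_mkQ]

theorem comp_mem_sectVals_of_range_eq {P : Set BinMatroid} (hP : IsHereditary P) {m n : ℕ}
    {φ ψ : F2 m →ₗ[ZMod 2] F2 n} (hφ : Injective φ) (hψ : Injective ψ)
    (h : LinearMap.range φ = LinearMap.range ψ) {g : F2 n → Bool}
    (hg : g ∘ φ ∈ sectVals P m) : g ∘ ψ ∈ sectVals P m := by
  let e : F2 m ≃ₗ[ZMod 2] F2 m :=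
    (LinearEquiv.ofInjective ψ hψ).trans
      ((LinearEquiv.ofEq _ _ h.symm).trans (LinearEquiv.ofInjective φ hφ).symm)
  have he : ∀ x, φ (e x) = ψ x := by
    intro x
    have := congrArg Subtype.val ((LinearEquiv.ofInjective φ hφ).apply_symm_apply
      (LinearEquiv.ofEq _ _ h.symm (LinearEquiv.ofInjective ψ hψ x)))
    exact this
  have hcomp : g ∘ ψ = (g ∘ φ) ∘ e.toLinearMap := by
    funext x
    simp [he]
  rw [hcomp]
  exact sectVals_comp hP e.injective hg

theorem le_ncard_sectVals_extKP {P : Set BinMatroid} (hP : IsHereditary P) {k n : ℕ}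
    (hkn : k ≤ n) :
    (sectVals P (n - k)).ncard * 2 ^ (2 ^ n - 2 ^ (n - k)) ≤
      (sectVals (ExtKP k P) n).ncard := by
  obtain ⟨φ, hφ⟩ := exists_injective_F2 (Nat.sub_le n k)
  have h := ncard_setOf_comp_mem hφ (sectVals P (n - k))
  simp only [Fintype.card_fun, ZMod.card, Fintype.card_fin] at h
  rw [← h]
  exact Set.ncard_le_ncard (fun g hg => (mem_sectVals_extKP hP hkn g).2 ⟨φ, hφ, hg⟩)
    (Set.toFinite _)

theorem ncard_sectVals_extKP_le {P : Set BinMatroid} (hP : IsHereditary P) {k n : ℕ}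
    (hkn : k ≤ n) :
    (sectVals (ExtKP k P) n).ncard ≤
      2 ^ (k * n) * ((sectVals P (n - k)).ncard * 2 ^ (2 ^ n - 2 ^ (n - k))) := by
  classical
  have : Finite (F2 n →ₗ[ZMod 2] F2 k) := Module.finite_of_finite (ZMod 2)
  have := Fintype.ofFinite (F2 n →ₗ[ZMod 2] F2 k)
  let C : (F2 n →ₗ[ZMod 2] F2 k) → Set (F2 n → Bool) := fun L =>
    {g | ∃ φ : F2 (n - k) →ₗ[ZMod 2] F2 n, Injective φ ∧
      LinearMap.ker L = LinearMap.range φ ∧ g ∘ φ ∈ sectVals P (n - k)}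
  have hC : ∀ L, (C L).ncard ≤ (sectVals P (n - k)).ncard * 2 ^ (2 ^ n - 2 ^ (n - k)) := by
    intro L
    rcases (C L).eq_empty_or_nonempty with h | ⟨_, ψ, hψ, hL, _⟩
    · simp [h]
    · have h := ncard_setOf_comp_mem hψ (sectVals P (n - k))
      simp only [Fintype.card_fun, ZMod.card, Fintype.card_fin] at h
      rw [← h]
      refine Set.ncard_le_ncard ?_ (Set.toFinite _)
      rintro g ⟨φ, hφ, hL', hg⟩
      exact comp_mem_sectVals_of_range_eq hP hφ hψ (hL'.symm.trans hL) hg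
  have hcard : Fintype.card (F2 n →ₗ[ZMod 2] F2 k) = 2 ^ (k * n) := by
    rw [Module.card_eq_pow_finrank (K := ZMod 2), Module.finrank_linearMap,
      Module.finrank_fin_fun, Module.finrank_fin_fun, ZMod.card, mul_comm]
  have hsub : sectVals (ExtKP k P) n ⊆ ⋃ L, C L := by
    intro g hg
    obtain ⟨φ, hφ, hg⟩ := (mem_sectVals_extKP hP hkn g).1 hg
    obtain ⟨L, hL⟩ := exists_ker_eq_range hkn hφ
    exact Set.mem_iUnion.2 ⟨L, φ, hφ, hL, hg⟩
  calc (sectVals (ExtKP k P) n).ncard ≤ (⋃ L, C L).ncard :=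
        Set.ncard_le_ncard hsub (Set.toFinite _)
    _ ≤ ∑ L, (C L).ncard := Set.ncard_iUnion_le_of_fintype C
    _ ≤ ∑ _L : F2 n →ₗ[ZMod 2] F2 k,
          (sectVals P (n - k)).ncard * 2 ^ (2 ^ n - 2 ^ (n - k)) :=
        Finset.sum_le_sum fun L _ => hC L
    _ = _ := by rw [Finset.sum_const, Finset.card_univ, hcard, smul_eq_mul]

/-- for a non-trivial hereditary matroid property `𝒯` and `k ≤ n`,
`h(n-k, 𝒯) + (1 - 2^{-k}) 2ⁿ ≤ h(n, Ext^k(𝒯)) ≤ h(n-k, 𝒯) + (1 - 2^{-k}) 2ⁿ + kn`. -/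
theorem entropy_ext (𝒯 : Set BinMatroid) (hher : IsHereditary 𝒯) (hnt : NonTrivial 𝒯)
    (k n : ℕ) (hkn : k ≤ n) :
    entropy 𝒯 (n - k) + (1 - ((2 : ℝ) ^ k)⁻¹) * 2 ^ n ≤ entropy (ExtKP k 𝒯) n ∧
    entropy (ExtKP k 𝒯) n ≤
      entropy 𝒯 (n - k) + (1 - ((2 : ℝ) ^ k)⁻¹) * 2 ^ n + k * n := by
  have hT : 0 < (sectVals 𝒯 (n - k)).ncard :=
    (Set.ncard_pos (Set.toFinite _)).2 (sectVals_nonempty hher hnt _)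
  have hlow := le_ncard_sectVals_extKP hher hkn
  have hupp := ncard_sectVals_extKP_le hher hkn
  rw [ncard_sectVals] at hT
  rw [ncard_sectVals, ncard_sectVals] at hlow hupp
  have hexp : (1 - ((2 : ℝ) ^ k)⁻¹) * 2 ^ n = ((2 ^ n - 2 ^ (n - k) : ℕ) : ℝ) := by
    rw [Nat.cast_sub (Nat.pow_le_pow_right two_pos (Nat.sub_le n k))]
    push_cast
    rw [pow_sub₀ _ two_ne_zero hkn]
    ring
  unfold entropy
  rw [hexp]
  generalize (sect 𝒯 (n - k)).ncard = a at *
  generalize (sect (ExtKP k 𝒯) n).ncard = b at *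
  generalize 2 ^ n - 2 ^ (n - k) = N at *
  have hb : 0 < b := lt_of_lt_of_le (by positivity) hlow
  have ha' : (0 : ℝ) < a := by exact_mod_cast hT
  have hb' : (0 : ℝ) < b := by exact_mod_cast hb
  have hlow' : (a : ℝ) * 2 ^ N ≤ b := by exact_mod_cast hlow
  have hupp' : (b : ℝ) ≤ 2 ^ (k * n) * (a * 2 ^ N) := by exact_mod_cast hupp
  have hpow : ∀ j : ℕ, Real.logb 2 ((2 : ℝ) ^ j) = j := fun j => by
    rw [Real.logb_pow, Real.logb_self_eq_one one_lt_two, mul_one]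
  have hlog : Real.logb 2 ((a : ℝ) * 2 ^ N) = Real.logb 2 a + N := by
    rw [Real.logb_mul ha'.ne' (by positivity), hpow]
  constructor
  · rw [← hlog]
    exact Real.logb_le_logb_of_le one_lt_two (by positivity) hlow'
  · refine (Real.logb_le_logb_of_le one_lt_two hb' hupp').trans_eq ?_
    rw [Real.logb_mul (by positivity) (by positivity), hlog, hpow]
    push_cast
    ring
end

section
/- Every non-trivial hereditary matroid property contains either all identically-zero matroids or all identically-one matroids. Consequently, the property 𝒪 of all identically-zero matroids and the property ℐ of all identically-one matroids are the only minimal (under inclusion) non-trivial hereditary matroid properties. -/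
open Function Filter Asymptotics

/-- `𝒪` : the property of all identically-zero matroids. -/
def OProp : Set BinMatroid := {M | ∀ x : F2 M.dim, M.val x = false}

/-- `ℐ` : the property of all identically-one matroids. -/
def IProp : Set BinMatroid := {M | ∀ x : F2 M.dim, x ≠ 0 → M.val x = true}

/-- The nonempty finite sums of distinct unit vectors `e_k, e_{k+1}, …` are nonzero and vanish
on the coordinates below `k`. -/
lemma ne_zero_of_mem_FS_single {a : Stream' (ℕ → ZMod 2)} {m : ℕ → ZMod 2}
    (hm : m ∈ Hindman.FS a) :
    ∀ k : ℕ, (∀ i, a.get i = Pi.single (k + i) 1) → m ≠ 0 ∧ ∀ i < k, m i = 0 := by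
  induction hm with
  | head' a =>
    intro k hk
    have h0 : a.head = Pi.single k 1 := hk 0
    rw [h0]
    refine ⟨by simp, fun i hi => ?_⟩
    simp [hi.ne]
  | tail' a m hm ih =>
    intro k hk
    obtain ⟨h1, h2⟩ := ih (k + 1) (fun i => by
      rw [Stream'.get_tail, hk]; congr 1; omega)
    exact ⟨h1, fun i hi => h2 i (by omega)⟩
  | cons' a m hm ih =>
    intro k hk
    have h0 : a.head = Pi.single k 1 := hk 0
    obtain ⟨h1, h2⟩ := ih (k + 1) (fun i => by
      rw [Stream'.get_tail, hk]; congr 1; omega)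
    rw [h0]
    refine ⟨fun h => ?_, fun i hi => ?_⟩
    · have := congrFun h k
      simp [h2 k (by omega)] at this
    · simp [hi.ne, h2 i (by omega)]

/-- A two-colouring of the nonzero vectors of `ℕ → ZMod 2` admits a sequence all of whose
nonempty finite sums are nonzero and of the same colour. -/
lemma exists_monochromatic_FS (C : Bool → Set (ℕ → ZMod 2)) (hC : ∀ x, ∃ c, x ∈ C c) :
    ∃ (c : Bool) (b : Stream' (ℕ → ZMod 2)), ∀ x ∈ Hindman.FS b, x ≠ 0 ∧ x ∈ C c := by
  let a : Stream' (ℕ → ZMod 2) := fun i => Pi.single i 1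
  obtain ⟨s, ⟨c, rfl⟩, b, hb⟩ := Hindman.FS_partition_regular a
    (Set.range fun c => {x | x ≠ 0 ∧ x ∈ C c}) (Set.finite_range _) (by
      intro x hx
      obtain ⟨c, hc⟩ := hC x
      exact ⟨_, ⟨c, rfl⟩, (ne_zero_of_mem_FS_single hx 0 fun i => by simp [a, Stream'.get]).1, hc⟩)
  exact ⟨c, b, fun x hx => hb hx⟩

/-- A nonzero combination over `ZMod 2` of the first `d` terms of a sequence is one of its
finite sums. -/
lemma linearCombination_mem_FS {V : Type*} [AddCommGroup V] [Module (ZMod 2) V] (b : Stream' V)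
    {d : ℕ} {x : Fin d → ZMod 2} (hx : x ≠ 0) :
    Fintype.linearCombination (ZMod 2) (fun i : Fin d => b.get i) x ∈ Hindman.FS b := by
  have h01 : ∀ t : ZMod 2, t ≠ 0 → t = 1 := by decide
  have key : Fintype.linearCombination (ZMod 2) (fun i : Fin d => b.get i) x =
      ∑ i ∈ (Finset.univ.filter fun i => x i ≠ 0).map Fin.valEmbedding, b.get i := by
    rw [Fintype.linearCombination_apply, Finset.sum_map, Finset.sum_filter]
    refine Finset.sum_congr rfl fun i _ => ?_
    split_ifs with h
    · simp [h01 _ h]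
    · simp [not_not.1 h]
  rw [key]
  obtain ⟨i, hi⟩ := Function.ne_iff.1 hx
  exact Hindman.FS.finsetSum b _ ⟨i, by simpa [Fin.val_inj] using hi⟩

/-- A non-trivial property contains, for some fixed colour, matroids with monochromatic subspaces
of every dimension. -/
lemma NonTrivial.exists_monochromatic {P : Set BinMatroid} (hP : NonTrivial P) :
    ∃ c : Bool, ∀ d : ℕ, ∃ M ∈ P, ∃ φ : F2 d →ₗ[ZMod 2] F2 M.dim,
      Injective φ ∧ ∀ x, x ≠ 0 → M.val (φ x) = c := by
  choose M hMP hM using hP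
  let τ (n : ℕ) : (ℕ → ZMod 2) →ₗ[ZMod 2] F2 (M n).dim :=
    LinearMap.funLeft (ZMod 2) (ZMod 2) Fin.val
  obtain ⟨c, b, hb⟩ := exists_monochromatic_FS
    (fun c => {x | ∀ᶠ n in (hyperfilter ℕ : Filter ℕ), (M n).val (τ n x) = c}) (fun x => by
      have h : ∀ᶠ n in (hyperfilter ℕ : Filter ℕ),
          (M n).val (τ n x) = true ∨ (M n).val (τ n x) = false :=
        Eventually.of_forall fun n => by cases (M n).val (τ n x) <;> simp
      rcases Ultrafilter.eventually_or.1 h with h | h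
      · exact ⟨true, h⟩
      · exact ⟨false, h⟩)
  refine ⟨c, fun d => ?_⟩
  let ψ : F2 d →ₗ[ZMod 2] (ℕ → ZMod 2) :=
    Fintype.linearCombination (ZMod 2) (fun i : Fin d => b.get i)
  have hψ (x : F2 d) (hx : x ≠ 0) := hb (ψ x) (linearCombination_mem_FS b hx)
  have hev : ∀ᶠ n in (hyperfilter ℕ : Filter ℕ), ∀ x : F2 d, x ≠ 0 →
      τ n (ψ x) ≠ 0 ∧ (M n).val (τ n (ψ x)) = c := by
    refine eventually_all.2 fun x => eventually_imp_distrib_left.2 fun hx => ?_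
    obtain ⟨h0, hc⟩ := hψ x hx
    obtain ⟨j, hj⟩ := Function.ne_iff.1 h0
    have hlarge : ∀ᶠ n in (hyperfilter ℕ : Filter ℕ), j < n :=
      (Nat.hyperfilter_le_atTop : _) (eventually_gt_atTop j)
    filter_upwards [hc, hlarge] with n hn hjn
    exact ⟨fun h => hj (congrFun h ⟨j, hjn.trans_le (hM n)⟩), hn⟩
  obtain ⟨n, hn⟩ := hev.exists
  refine ⟨M n, hMP n, τ n ∘ₗ ψ, ?_, fun x hx => (hn x hx).2⟩
  refine (injective_iff_map_eq_zero _).2 fun x hx => ?_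
  by_contra h
  exact (hn x h).1 hx

/-- Every non-trivial hereditary property contains all identically-zero matroids or all
identically-one matroids. -/
lemma IsHereditary.OProp_subset_or_IProp_subset {P : Set BinMatroid} (hP : IsHereditary P)
    (hnt : NonTrivial P) : OProp ⊆ P ∨ IProp ⊆ P := by
  obtain ⟨c, hc⟩ := hnt.exists_monochromatic
  cases c
  · refine Or.inl fun N hN => ?_
    obtain ⟨M, hM, φ, hφ, h⟩ := hc N.dim
    exact hP M hM N ⟨φ, hφ, fun x hx => (hN x).trans (h x hx).symm⟩
  · refine Or.inr fun N hN => ?_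
    obtain ⟨M, hM, φ, hφ, h⟩ := hc N.dim
    exact hP M hM N ⟨φ, hφ, fun x hx => (hN x hx).trans (h x hx).symm⟩

lemma isHereditary_OProp : IsHereditary OProp := by
  rintro M hM N ⟨φ, -, h⟩ x
  by_cases hx : x = 0
  · rw [hx, N.val0]
  · rw [h x hx, hM]

lemma nonTrivial_OProp : NonTrivial OProp :=
  fun n => ⟨⟨n, fun _ => false, rfl⟩, fun _ => rfl, le_rfl⟩

lemma isHereditary_IProp : IsHereditary IProp := by
  rintro M hM N ⟨φ, hφ, h⟩ x hx
  rw [h x hx, hM _ ((map_ne_zero_iff φ hφ).2 hx)]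

lemma nonTrivial_IProp : NonTrivial IProp :=
  fun n => ⟨⟨n, fun x => decide (x ≠ 0), by simp⟩, fun x hx => by simpa using hx, le_rfl⟩

/-- No matroid of positive dimension is both identically zero and identically one. -/
lemma dim_eq_zero_of_mem_OProp_of_mem_IProp {M : BinMatroid} (hO : M ∈ OProp) (hI : M ∈ IProp) :
    M.dim = 0 := by
  by_contra h
  have : Nonempty (Fin M.dim) := ⟨⟨0, Nat.pos_of_ne_zero h⟩⟩
  obtain ⟨x, hx⟩ := exists_ne (0 : F2 M.dim)
  simpa [hO x] using hI x hx

/-- every non-trivial hereditary matroid property contains `𝒪` or `ℐ`;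
consequently `𝒪` and `ℐ` are the only minimal non-trivial hereditary matroid
properties. -/
theorem minimal_hereditary_properties :
    IsHereditary OProp ∧ NonTrivial OProp ∧ IsHereditary IProp ∧ NonTrivial IProp ∧
    (∀ P : Set BinMatroid, IsHereditary P → NonTrivial P → OProp ⊆ P ∨ IProp ⊆ P) ∧
    (∀ Q : Set BinMatroid, IsHereditary Q → NonTrivial Q → Q ⊆ OProp → Q = OProp) ∧
    (∀ Q : Set BinMatroid, IsHereditary Q → NonTrivial Q → Q ⊆ IProp → Q = IProp) ∧
    (∀ P : Set BinMatroid, IsHereditary P → NonTrivial P →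
      (∀ Q : Set BinMatroid, IsHereditary Q → NonTrivial Q → Q ⊆ P → Q = P) →
      P = OProp ∨ P = IProp) := by
  have not_subset {P : Set BinMatroid} (hP : NonTrivial P) (hO : P ⊆ OProp) : ¬ P ⊆ IProp := by
    intro hI
    obtain ⟨M, hM, hd⟩ := hP 1
    have := dim_eq_zero_of_mem_OProp_of_mem_IProp (hO hM) (hI hM)
    omega
  refine ⟨isHereditary_OProp, nonTrivial_OProp, isHereditary_IProp, nonTrivial_IProp,
    fun P hP hnt => hP.OProp_subset_or_IProp_subset hnt, fun Q hQ hnt hsub => ?_,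
    fun Q hQ hnt hsub => ?_, fun P hP hnt hmin => ?_⟩
  · rcases hQ.OProp_subset_or_IProp_subset hnt with h | h
    · exact hsub.antisymm h
    · exact absurd subset_rfl (not_subset nonTrivial_IProp (h.trans hsub))
  · rcases hQ.OProp_subset_or_IProp_subset hnt with h | h
    · exact absurd (h.trans hsub) (not_subset nonTrivial_OProp subset_rfl)
    · exact hsub.antisymm h
  · exact (hP.OProp_subset_or_IProp_subset hnt).imp
      (fun h => (hmin _ isHereditary_OProp nonTrivial_OProp h).symm)
      (fun h => (hmin _ isHereditary_IProp nonTrivial_IProp h).symm)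
end

section
/- Let U ⊆ W ⊆ V be binary projective spaces (i.e., U and W are subspaces of V with U a subspace of W), and let d = dim(V) − dim(W) + dim(U). Then there exist subspaces U₁, U₂, …, U_m of V with m ≥ 2^{dim(V) − 2d} such that dim(U_i) = d and U_i ∩ W = U for every i ∈ [m], and U_i ∩ U_j = U for every pair i ≠ j in [m]. -/
open Function

section PartialComplement

open Module

variable {K V F : Type*} [Field K] [AddCommGroup V] [Module K V] [AddCommGroup F] [Module K F]
  {U W : Submodule K V}

/-- The quotient map `W → W / U`, identified with a map to a space of the right dimension, extends
to the whole space. -/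
theorem exists_linearMap_ker_inf_eq [FiniteDimensional K V] [FiniteDimensional K F] (hUW : U ≤ W)
    (hF : finrank K F + finrank K U = finrank K W) :
    ∃ p : V →ₗ[K] F, LinearMap.ker p ⊓ W = U ∧ W.map p = ⊤ := by
  have hU : finrank K (U.comap W.subtype) = finrank K U :=
    (Submodule.comapSubtypeEquivOfLe hUW).finrank_eq
  have hq := Submodule.finrank_quotient_add_finrank (U.comap W.subtype)
  let e : (W ⧸ U.comap W.subtype) ≃ₗ[K] F := LinearEquiv.ofFinrankEq _ _ (by lia)
  obtain ⟨p, hp⟩ := LinearMap.exists_extend (e.toLinearMap ∘ₗ (U.comap W.subtype).mkQ)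
  have hpW (x : V) (hx : x ∈ W) : p x = e ((U.comap W.subtype).mkQ ⟨x, hx⟩) :=
    LinearMap.congr_fun hp ⟨x, hx⟩
  have hker (x : V) (hx : x ∈ W) : p x = 0 ↔ x ∈ U := by
    simp [hpW x hx]
  refine ⟨p, ?_, ?_⟩
  · ext x
    simp only [Submodule.mem_inf, LinearMap.mem_ker]
    exact ⟨fun h => (hker x h.2).1 h.1, fun h => ⟨(hker x (hUW h)).2 h, hUW h⟩⟩
  · refine (Submodule.eq_top_iff'.2 fun y => ?_)
    obtain ⟨⟨x, hx⟩, hxy⟩ := (U.comap W.subtype).mkQ_surjective (e.symm y)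
    exact ⟨x, hx, by rw [hpW x hx, hxy, e.apply_symm_apply]⟩

theorem finrank_ker_of_map_eq_top [FiniteDimensional K V]
    (hF : finrank K F + finrank K U = finrank K W) {p : V →ₗ[K] F} (hp : W.map p = ⊤) :
    finrank K (LinearMap.ker p) = finrank K V - finrank K W + finrank K U := by
  have hr : LinearMap.range p = ⊤ := top_le_iff.1 (hp ▸ LinearMap.map_le_range)
  have h := p.finrank_range_add_finrank_ker
  have hW := W.finrank_le
  rw [hr, finrank_top] at h
  lia

/-- Twisting `p` by multiples of a map with kernel `W` gives subspaces meeting pairwise in `U`. -/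
theorem exists_family_inf_eq {L : Type*} [Field L] [Algebra K L] [FiniteDimensional K L]
    [FiniteDimensional K V] (hUW : U ≤ W) (hL : finrank K L + finrank K U = finrank K W)
    (hV : finrank K V ≤ finrank K W + finrank K L) :
    ∃ S : L → Submodule K V,
      (∀ a, finrank K (S a) = finrank K V - finrank K W + finrank K U) ∧
      (∀ a, S a ⊓ W = U) ∧ ∀ a b, a ≠ b → S a ⊓ S b = U := by
  obtain ⟨p, hpU, hpW⟩ := exists_linearMap_ker_inf_eq hUW hL
  have hq := W.finrank_quotient_add_finrank
  obtain ⟨j, hj⟩ := (finrank_le_iff_exists_linearMap (R := K) (M := V ⧸ W) (M' := L)).1 (by lia)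
  let q : V →ₗ[K] L := j ∘ₗ W.mkQ
  have hqW (x : V) : q x = 0 ↔ x ∈ W := by
    simp [q, map_eq_zero_iff j hj]
  have hpU' (x : V) : x ∈ U ↔ p x = 0 ∧ x ∈ W := by
    rw [← hpU]; simp
  let f (a : L) : V →ₗ[K] L := p + LinearMap.mulLeft K a ∘ₗ q
  have hf (a : L) (x : V) : f a x = p x + a * q x := rfl
  have hfW (a : L) (x : V) (hx : x ∈ W) : f a x = p x := by
    rw [hf, (hqW x).2 hx, mul_zero, add_zero]
  refine ⟨fun a => LinearMap.ker (f a), fun a => finrank_ker_of_map_eq_top hL ?_, fun a => ?_,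
    fun a b hab => ?_⟩
  · rw [← hpW]
    exact SetLike.coe_injective (Set.image_congr (hfW a))
  · ext x
    rw [Submodule.mem_inf, LinearMap.mem_ker, hpU']
    exact and_congr_left fun hx => by rw [hfW a x hx]
  · ext x
    rw [Submodule.mem_inf, LinearMap.mem_ker, LinearMap.mem_ker]
    constructor
    · rintro ⟨ha, hb⟩
      have h : (a - b) * q x = 0 := by
        rw [hf] at ha hb
        linear_combination ha - hb
      have hx : x ∈ W := (hqW x).1 ((mul_eq_zero.1 h).resolve_left (sub_ne_zero.2 hab))
      exact (hpU' x).2 ⟨by rw [← hfW a x hx, ha], hx⟩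
    · intro hx
      obtain ⟨h0, hx⟩ := (hpU' x).1 hx
      exact ⟨by rw [hfW a x hx, h0], by rw [hfW b x hx, h0]⟩

end PartialComplement

/-- Lemma 3.1: let `U ⊆ W ⊆ V = 𝔽₂ⁿ` and
`d = dim V - dim W + dim U`. Then there are at least `2^{dim V - 2d}` subspaces
`U₁, …, U_m` of `V` with `dim Uᵢ = d`, `Uᵢ ∩ W = U` for all `i`, and
`Uᵢ ∩ Uⱼ = U` for all `i ≠ j`. -/
theorem subspace_packing (n : ℕ) (U W : Submodule (ZMod 2) (F2 n)) (hUW : U ≤ W) :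
    ∃ (m : ℕ) (Us : Fin m → Submodule (ZMod 2) (F2 n)),
      2 ^ (n - 2 * (n - Module.finrank (ZMod 2) W + Module.finrank (ZMod 2) U)) ≤ m ∧
      (∀ i, Module.finrank (ZMod 2) (Us i) =
        n - Module.finrank (ZMod 2) W + Module.finrank (ZMod 2) U) ∧
      (∀ i, Us i ⊓ W = U) ∧
      (∀ i j, i ≠ j → Us i ⊓ Us j = U) := by
  have hV : Module.finrank (ZMod 2) (F2 n) = n := by simp
  have hWn := W.finrank_le
  have hUW' := Submodule.finrank_mono hUW
  by_cases h : n ≤ 2 * (n - Module.finrank (ZMod 2) W + Module.finrank (ZMod 2) U)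
  · have hF : Module.finrank (ZMod 2) (F2 (Module.finrank (ZMod 2) W -
        Module.finrank (ZMod 2) U)) + Module.finrank (ZMod 2) U = Module.finrank (ZMod 2) W := by
      simp only [Module.finrank_fin_fun]
      lia
    obtain ⟨p, hpU, hpW⟩ := exists_linearMap_ker_inf_eq hUW hF
    refine ⟨1, fun _ => LinearMap.ker p, ?_, fun _ => ?_, fun _ => hpU,
      fun i j hij => absurd (Subsingleton.elim i j) hij⟩
    · rw [Nat.sub_eq_zero_of_le h, pow_zero]
    · rw [finrank_ker_of_map_eq_top hF hpW, hV]
  · set N := Module.finrank (ZMod 2) W - Module.finrank (ZMod 2) U with hN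
    have hN0 : N ≠ 0 := by lia
    have hL : Module.finrank (ZMod 2) (GaloisField 2 N) = N := GaloisField.finrank 2 hN0
    obtain ⟨S, hSd, hSW, hS⟩ := exists_family_inf_eq (L := GaloisField 2 N) hUW (by lia) (by lia)
    let e := Finite.equivFin (GaloisField 2 N)
    refine ⟨_, fun i => S (e.symm i), ?_, fun i => ?_, fun i => hSW _,
      fun i j hij => hS _ _ (e.symm.injective.ne hij)⟩
    · rw [GaloisField.card 2 N hN0]
      exact Nat.pow_le_pow_right two_pos (by lia)
    · rw [hSd, hV]
end

section
/- For every d ≥ 1 there exists ε > 0 (one may take ε = 2^{−2^{d+1}}) satisfying the following. Let n ≥ d ≥ k ≥ 1 be integers, let V be a binary projective space with dim(V) = n, let W be a subspace of V of codimension k, and let N be a pattern with dim(N) = d − k. Let M be a matroid with V(M) = W containing an N-instance. Then for every pattern N' ∈ Ext^k(N), the number of N'-free matroids M' : V → {0,1} whose restriction to W equals M is at most 2^{2ⁿ(1 − 2^{−k} − ε)}. -/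
open Function

/-- An instance of a pattern `A : 𝔽₂^m ∖ {0} → {0,1,⋆}` (with `⋆ = none`) in a matroid
`g : 𝔽₂ⁿ ∖ {0} → {0,1}`: an injective linear map `φ` such that `g (φ x) = A x`
whenever `x ≠ 0` and `A x ∈ {0,1}`. -/
def PatternInstance {m n : ℕ} (A : F2 m → Option Bool) (g : F2 n → Bool) : Prop :=
  ∃ φ : F2 m →ₗ[ZMod 2] F2 n, Injective φ ∧
    ∀ x : F2 m, x ≠ 0 → ∀ b : Bool, A x = some b → g (φ x) = b

open Finset in
/-- Among all functions `g : α → Bool`, those which disagree with a prescribed pattern `p i`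
somewhere on each of the pairwise disjoint blocks `A i` have density at most
`∏ i, (1 - 2 ^ (-|A i|))`. -/
theorem card_avoiding_disjoint_blocks_le {α β : Type*} [Fintype α] [DecidableEq α]
    (A : β → Finset α) (p : β → α → Bool) (I : Finset β)
    (hA : (I : Set β).PairwiseDisjoint A) :
    (#{g : α → Bool | ∀ i ∈ I, ∃ x ∈ A i, g x ≠ p i x} : ℝ) ≤
      2 ^ Fintype.card α * ∏ i ∈ I, (1 - ((2 : ℝ) ^ #(A i))⁻¹) := by
  classical
  induction I using Finset.induction_on with
  | empty => simp
  | insert j I hj ih =>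
    have hdisj : ∀ i ∈ I, Disjoint (A i) (A j) := fun i hi =>
      hA (by simp [hi]) (by simp) (by rintro rfl; exact hj hi)
    specialize ih (hA.subset (by simp))
    set G : Finset (α → Bool) := {g | ∀ i ∈ I, ∃ x ∈ A i, g x ≠ p i x} with hG
    set H : Finset (α → Bool) := {g ∈ G | ∀ x ∈ A j, g x = p j x} with hH
    have hsplit : #{g : α → Bool | ∀ i ∈ insert j I, ∃ x ∈ A i, g x ≠ p i x} + #H = #G := by
      rw [add_comm, hH,
        ← card_filter_add_card_filter_not (s := G) (fun g => ∀ x ∈ A j, g x = p j x)]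
      congr 2
      ext g
      simp [hG, and_comm]
    have hfib : #G ≤ 2 ^ #(A j) * #H := by
      refine card_le_mul_card_image_of_maps_to
        (f := fun g x => if x ∈ A j then p j x else g x) ?_ _ ?_
      · intro g hg
        simp only [hH, hG, mem_filter, mem_univ, true_and] at hg ⊢
        refine ⟨fun i hi => ?_, fun x hx => by simp [hx]⟩
        obtain ⟨x, hx, hne⟩ := hg i hi
        exact ⟨x, hx, by simpa [Finset.disjoint_left.1 (hdisj i hi) hx] using hne⟩
      · intro h _
        rw [← card_powerset]
        refine card_le_card_of_injOn (fun g => {x ∈ A j | g x = true})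
          (fun g _ => mem_coe.2 (mem_powerset.2 (filter_subset _ _))) ?_
        intro g hg g' hg' heq
        replace hg := (mem_filter.1 (mem_coe.1 hg)).2
        replace hg' := (mem_filter.1 (mem_coe.1 hg')).2
        funext x
        by_cases hx : x ∈ A j
        · have := Finset.ext_iff.1 heq x
          rw [Bool.eq_iff_iff]
          simpa only [mem_filter, hx, true_and] using this
        · have := congrFun (hg.trans hg'.symm) x
          simpa only [hx, if_false] using this
    have hfib' : (#G : ℝ) ≤ 2 ^ #(A j) * #H := by exact_mod_cast hfib
    have hsplit' : (#{g : α → Bool | ∀ i ∈ insert j I, ∃ x ∈ A i, g x ≠ p i x} : ℝ) + #H = #G := by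
      exact_mod_cast hsplit
    have hpos : (0 : ℝ) < 2 ^ #(A j) := by positivity
    have hle : ((2 : ℝ) ^ #(A j))⁻¹ ≤ 1 := inv_le_one_of_one_le₀ (one_le_pow₀ one_le_two)
    have h1 : ((2 : ℝ) ^ #(A j))⁻¹ * #G ≤ #H := (inv_mul_le_iff₀ hpos).2 hfib'
    rw [prod_insert hj]
    calc _ ≤ (1 - ((2 : ℝ) ^ #(A j))⁻¹) * #G := by linarith
      _ ≤ (1 - ((2 : ℝ) ^ #(A j))⁻¹) *
          (2 ^ Fintype.card α * ∏ i ∈ I, (1 - ((2 : ℝ) ^ #(A i))⁻¹)) :=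
        mul_le_mul_of_nonneg_left ih (by linarith)
      _ = _ := by ring

/-- There is an injective linear map `𝔽₂^a → 𝔽₂^b` for `a ≤ b`. -/
theorem exists_injective_linearMap_F2 {a b : ℕ} (h : a ≤ b) :
    ∃ f : F2 a →ₗ[ZMod 2] F2 b, Injective f :=
  finrank_le_iff_exists_linearMap.1 (by simpa using h)

/-- The range of an injective linear map of `𝔽₂`-spaces is the kernel of a split surjection. -/
theorem exists_cokernel_F2 {a b : ℕ} (f : F2 a →ₗ[ZMod 2] F2 b) (hf : Injective f) :
    ∃ (q : F2 b →ₗ[ZMod 2] F2 (b - a)) (j : F2 (b - a) →ₗ[ZMod 2] F2 b),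
      (∀ x, q x = 0 ↔ ∃ y, f y = x) ∧ ∀ s, q (j s) = s := by
  have hrank : Module.finrank (ZMod 2) (F2 b ⧸ LinearMap.range f) =
      Module.finrank (ZMod 2) (F2 (b - a)) := by
    have h1 := Submodule.finrank_quotient_add_finrank (LinearMap.range f)
    rw [LinearMap.finrank_range_of_inj hf] at h1
    simp only [Module.finrank_fin_fun] at h1 ⊢
    omega
  let e := LinearEquiv.ofFinrankEq _ _ hrank
  let q := e.toLinearMap ∘ₗ (LinearMap.range f).mkQ
  have hq : LinearMap.range q = ⊤ :=
    LinearMap.range_eq_top.2 (e.surjective.comp (Submodule.mkQ_surjective _))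
  obtain ⟨j, hj⟩ := q.exists_rightInverse_of_surjective hq
  exact ⟨q, j, fun x => by simp [q], fun s => LinearMap.congr_fun hj s⟩

/-- A family of at least `2 ^ (m - c)` linear maps `𝔽₂^c → 𝔽₂^m`, any two of which disagree at
every nonzero vector. For `c < m` it is given by scalar multiplication in the field with `2 ^ m`
elements. -/
theorem exists_pairwise_disagreeing_linearMaps (c m : ℕ) :
    ∃ (S : Finset (F2 m)) (T : F2 m → (F2 c →ₗ[ZMod 2] F2 m)),
      2 ^ m ≤ S.card * 2 ^ c ∧
      ∀ a ∈ S, ∀ b ∈ S, ∀ s ≠ 0, T a s = T b s → a = b := by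
  rcases le_or_gt m c with h | h
  · refine ⟨{0}, 0, by simpa using Nat.pow_le_pow_right two_pos h, ?_⟩
    simp
  · have hrank : Module.finrank (ZMod 2) (GaloisField 2 m) = Module.finrank (ZMod 2) (F2 m) := by
      rw [GaloisField.finrank 2 (by omega), Module.finrank_fin_fun]
    let e : GaloisField 2 m ≃ₗ[ZMod 2] F2 m := LinearEquiv.ofFinrankEq _ _ hrank
    obtain ⟨f, hf⟩ := exists_injective_linearMap_F2 h.le
    refine ⟨Finset.univ, fun a => e.toLinearMap ∘ₗ LinearMap.mulLeft (ZMod 2) (e.symm a) ∘ₗ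
      e.symm.toLinearMap ∘ₗ f, ?_, fun a _ b _ s hs hab => ?_⟩
    · simpa using Nat.le_mul_of_pos_right (2 ^ m) (Nat.two_pow_pos c)
    · simp only [LinearMap.comp_apply, LinearEquiv.coe_coe, LinearMap.mulLeft_apply,
        EmbeddingLike.apply_eq_iff_eq] at hab
      have hne : e.symm (f s) ≠ 0 := by simpa [map_eq_zero_iff f hf] using hs
      exact e.symm.injective (mul_right_cancel₀ hne hab)

open Finset in
/-- An instance of `N` on a subspace of `F2 n` extends to a family of linear maps on the domain
of `N'` whose values off the subspace are disjoint from each other and from the subspace. -/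
theorem exists_disjoint_extensions {d n k d' : ℕ} (hkd : k ≤ d) (hdn : d ≤ n) (hd' : d' ≤ d)
    (ι : F2 (n - k) →ₗ[ZMod 2] F2 n) (hι : Injective ι)
    (ψ : F2 (d - k) →ₗ[ZMod 2] F2 (n - k)) (hψ : Injective ψ)
    (ψ' : F2 (d - k) →ₗ[ZMod 2] F2 d') (hψ' : Injective ψ') :
    ∃ (β : Type) (S : Finset β) (φ : β → (F2 d' →ₗ[ZMod 2] F2 n)),
      2 ^ (n - d) ≤ #S * 2 ^ d ∧
      (∀ a, Injective (φ a)) ∧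
      (∀ a z, φ a (ψ' z) = ι (ψ z)) ∧
      (∀ a x w, φ a x = ι w → ∃ z, ψ' z = x) ∧
      ∀ a ∈ S, ∀ b ∈ S, ∀ x y, (¬ ∃ z, ψ' z = x) → φ a x = φ b y → a = b := by
  obtain ⟨q, -, hq, -⟩ := exists_cokernel_F2 ψ' hψ'
  obtain ⟨p, hp⟩ := ψ'.exists_leftInverse_of_injective (LinearMap.ker_eq_bot.2 hψ')
  obtain ⟨qι, j₀, hqι, hj₀⟩ := exists_cokernel_F2 ι hι
  obtain ⟨qψ, h, hqψ, hh⟩ := exists_cokernel_F2 ψ hψ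
  obtain ⟨i, hi⟩ := exists_injective_linearMap_F2 (a := d' - (d - k)) (b := n - (n - k)) (by omega)
  obtain ⟨S, T, hS, hT⟩ :=
    exists_pairwise_disagreeing_linearMaps (d' - (d - k)) (n - k - (d - k))
  have hp' : ∀ z, p (ψ' z) = z := fun z => LinearMap.congr_fun hp z
  have hqιι : ∀ w, qι (ι w) = 0 := fun w => (hqι _).2 ⟨w, rfl⟩
  have hqψψ : ∀ z, qψ (ψ z) = 0 := fun z => (hqψ _).2 ⟨z, rfl⟩
  have hqψ' : ∀ z, q (ψ' z) = 0 := fun z => (hq _).2 ⟨z, rfl⟩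
  let φ : F2 (n - k - (d - k)) → (F2 d' →ₗ[ZMod 2] F2 n) := fun a =>
    ι ∘ₗ ψ ∘ₗ p + j₀ ∘ₗ i ∘ₗ q + ι ∘ₗ h ∘ₗ T a ∘ₗ q
  have hφ : ∀ a x, φ a x = ι (ψ (p x)) + j₀ (i (q x)) + ι (h (T a (q x))) := fun _ _ => rfl
  have hqφ : ∀ a x, qι (φ a x) = i (q x) := fun a x => by simp [hφ, hqιι, hj₀]
  have hφψ : ∀ a z, φ a (ψ' z) = ι (ψ z) := fun a z => by simp [hφ, hp', hqψ']
  have hrange : ∀ a x w, φ a x = ι w → ∃ z, ψ' z = x := by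
    intro a x w hx
    have h1 : i (q x) = 0 := by rw [← hqφ a x, hx, hqιι]
    exact (hq x).1 ((map_eq_zero_iff i hi).1 h1)
  refine ⟨_, S, φ, ?_, fun a => ?_, hφψ, hrange, ?_⟩
  · rw [show n - d = n - k - (d - k) by omega]
    exact hS.trans (Nat.mul_le_mul_left _ (Nat.pow_le_pow_right two_pos (by omega)))
  · refine (injective_iff_map_eq_zero _).2 fun x hx => ?_
    obtain ⟨z, rfl⟩ := hrange a x 0 (by simpa using hx)
    rw [hφψ, map_eq_zero_iff ι hι, map_eq_zero_iff ψ hψ] at hx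
    simp [hx]
  · intro a ha b hb x y hx hxy
    have hqq : q x = q y := hi (by rw [← hqφ a, ← hqφ b, hxy])
    have h1 : ι (ψ (p x) + h (T a (q x))) = ι (ψ (p y) + h (T b (q x))) := by
      rw [hφ, hφ, ← hqq] at hxy
      rw [map_add, map_add]
      linear_combination hxy
    have h2 := congrArg qψ (hι h1)
    simp only [map_add, hqψψ, hh, zero_add] at h2
    exact hT a ha b hb (q x) (fun h0 => hx ((hq x).1 h0)) h2

/-- The numerical estimate for `r` blocks of size at most `2 ^ d`. -/
theorem one_sub_inv_pow_le_two_rpow {d n r : ℕ} (hdn : d ≤ n)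
    (hr : 2 ^ (n - d) ≤ r * 2 ^ d) :
    (1 - ((2 : ℝ) ^ 2 ^ d)⁻¹) ^ r ≤
      (2 : ℝ) ^ (-((2 : ℝ) ^ n * (((2 : ℝ) ^ 2 ^ d)⁻¹ * ((4 : ℝ) ^ d)⁻¹))) := by
  set t : ℝ := ((2 : ℝ) ^ 2 ^ d)⁻¹
  have ht0 : 0 < t := by positivity
  have ht1 : t ≤ 1 := inv_le_one_of_one_le₀ (one_le_pow₀ one_le_two)
  have hbase : 1 - t ≤ (2 : ℝ) ^ (-t) := by
    rw [Real.rpow_def_of_pos two_pos]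
    have h1 := Real.add_one_le_exp (-(Real.log 2 * t))
    have h2 : Real.log 2 ≤ 1 := by linarith [Real.log_two_lt_d9]
    rw [mul_neg]
    nlinarith
  have hr' : (2 : ℝ) ^ n * ((4 : ℝ) ^ d)⁻¹ ≤ r := by
    have h1 : (2 : ℝ) ^ (n - d) ≤ r * 2 ^ d := by exact_mod_cast hr
    rw [← div_eq_mul_inv, div_le_iff₀ (by positivity)]
    calc (2 : ℝ) ^ n = 2 ^ (n - d) * 2 ^ d := by rw [← pow_add, Nat.sub_add_cancel hdn]
      _ ≤ r * 2 ^ d * 2 ^ d := by gcongr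
      _ = r * 4 ^ d := by rw [mul_assoc, ← mul_pow]; norm_num
  calc (1 - t) ^ r ≤ ((2 : ℝ) ^ (-t)) ^ r := pow_le_pow_left₀ (by linarith) hbase r
    _ = (2 : ℝ) ^ (-t * r) := by rw [Real.rpow_mul_natCast two_pos.le]
    _ ≤ _ := by
      refine Real.rpow_le_rpow_of_exponent_le one_le_two ?_
      nlinarith

/-- Lemma 3.2: for every `d ≥ 1` there is `ε > 0` such that for all
`n ≥ d ≥ k ≥ 1`, every subspace `W` of `V = 𝔽₂ⁿ ∖ {0}` of codimension `k`
(given as the range of an injective linear map `ι : 𝔽₂^{n-k} → 𝔽₂ⁿ`),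
every pattern `N` of dimension `d - k`, every matroid `M` on `W` containing an
`N`-instance, and every pattern `N' ∈ Ext^k(N)` (of some dimension `d' ≤ d`, having
`N` as a restriction), the number of `N'`-free matroids on `V` whose restriction to `W`
is `M` is at most `2^{2ⁿ (1 - 2^{-k} - ε)}`. -/
theorem count_free_extensions (d : ℕ) (hd : 1 ≤ d) :
    ∃ ε : ℝ, 0 < ε ∧
      ∀ (n k : ℕ), 1 ≤ k → k ≤ d → d ≤ n →
      ∀ ι : F2 (n - k) →ₗ[ZMod 2] F2 n, Injective ι →
      ∀ (M : F2 (n - k) → Bool) (N : F2 (d - k) → Option Bool),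
      (∃ ψ : F2 (d - k) →ₗ[ZMod 2] F2 (n - k), Injective ψ ∧
        ∀ x : F2 (d - k), x ≠ 0 → ∀ b : Bool, N x = some b → M (ψ x) = b) →
      ∀ (d' : ℕ), d' ≤ d → ∀ N' : F2 d' → Option Bool,
      (∃ ψ' : F2 (d - k) →ₗ[ZMod 2] F2 d', Injective ψ' ∧
        ∀ x : F2 (d - k), x ≠ 0 → N x = N' (ψ' x)) →
      (({g : F2 n → Bool | g 0 = false ∧ (∀ x : F2 (n - k), x ≠ 0 → g (ι x) = M x) ∧
          ¬ PatternInstance N' g}).ncard : ℝ) ≤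
        (2 : ℝ) ^ ((2 : ℝ) ^ n * (1 - ((2 : ℝ) ^ k)⁻¹ - ε)) := by
  classical
  refine ⟨((2 : ℝ) ^ 2 ^ d)⁻¹ * ((4 : ℝ) ^ d)⁻¹, by positivity, ?_⟩
  rintro n k - hkd hdn ι hι M N ⟨ψ, hψ, hψM⟩ d' hd' N' ⟨ψ', hψ', hNN'⟩
  obtain ⟨β, S, φ, hS, hφinj, hφψ, hφι, hφdisj⟩ :=
    exists_disjoint_extensions hkd hdn hd' ι hι ψ hψ ψ' hψ'
  let A : F2 (n - k) ⊕ β → Finset (F2 n) :=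
    Sum.elim (fun w => {ι w}) fun a => (Finset.univ.filter fun x => ¬ ∃ z, ψ' z = x).image (φ a)
  let p : F2 (n - k) ⊕ β → F2 n → Bool :=
    Sum.elim (fun w _ => if w = 0 then true else !M w)
      fun a y => (N' (invFun (φ a) y)).getD false
  let I : Finset (F2 (n - k) ⊕ β) := Finset.univ.disjSum S
  have hA : (I : Set (F2 (n - k) ⊕ β)).PairwiseDisjoint A := by
    have hcross : ∀ w a, Disjoint (A (Sum.inl w)) (A (Sum.inr a)) := by
      intro w a
      simp only [A, Sum.elim_inl, Sum.elim_inr, Finset.disjoint_singleton_left, Finset.mem_image,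
        Finset.mem_filter, Finset.mem_univ, true_and, not_exists, not_and]
      exact fun x hx hxw => not_exists.2 hx (hφι a x w hxw)
    rintro (w | a) hi (v | b) hj hne
    · simpa [A, onFun, hι.eq_iff] using fun h => hne (congrArg _ h)
    · exact hcross w b
    · exact (hcross v a).symm
    · rw [onFun, Finset.disjoint_left]
      simp only [A, Sum.elim_inr, Finset.mem_image, Finset.mem_filter, Finset.mem_univ, true_and]
      rintro _ ⟨x, hx, rfl⟩ ⟨y, -, hxy⟩
      simp only [I, Finset.mem_coe, Finset.inr_mem_disjSum] at hi hj
      exact hne (congrArg _ (hφdisj a hi b hj x y hx hxy.symm))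
  have hsub : {g : F2 n → Bool | g 0 = false ∧ (∀ x : F2 (n - k), x ≠ 0 → g (ι x) = M x) ∧
      ¬ PatternInstance N' g} ⊆
      (Finset.univ.filter fun g : F2 n → Bool => ∀ i ∈ I, ∃ x ∈ A i, g x ≠ p i x :
        Finset (F2 n → Bool)) := by
    rintro g ⟨hg0, hgM, hgN⟩
    simp only [Finset.coe_filter, Finset.mem_univ, true_and, Set.mem_ofPred_eq]
    rintro (w | a) -
    · refine ⟨ι w, by simp [A], ?_⟩
      by_cases hw : w = 0
      · simp [p, hw, hg0]
      · simp [p, hw, hgM w hw]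
    · by_contra! hcon
      refine hgN ⟨φ a, hφinj a, fun x hx b hb => ?_⟩
      by_cases hxr : ∃ z, ψ' z = x
      · obtain ⟨z, rfl⟩ := hxr
        have hz : z ≠ 0 := fun h => hx (by simp [h])
        rw [hφψ, hgM _ (by simpa [map_eq_zero_iff ψ hψ] using hz)]
        exact hψM z hz b ((hNN' z hz).trans hb)
      · have h1 := hcon (φ a x)
          (Finset.mem_image_of_mem _ (Finset.mem_filter.2 ⟨Finset.mem_univ _, hxr⟩))
        simpa [p, leftInverse_invFun (hφinj a) x, hb] using h1
  have hcardA : ∀ a ∈ S, 1 - ((2 : ℝ) ^ (A (Sum.inr a)).card)⁻¹ ≤ 1 - ((2 : ℝ) ^ 2 ^ d)⁻¹ := by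
    intro a _
    have h1 : (A (Sum.inr a)).card ≤ 2 ^ d := by
      refine Finset.card_image_le.trans ((Finset.card_filter_le _ _).trans ?_)
      simpa using Nat.pow_le_pow_right two_pos hd'
    gcongr
    exact one_le_two
  have hprod : ∏ i ∈ I, (1 - ((2 : ℝ) ^ (A i).card)⁻¹) ≤
      (2 : ℝ)⁻¹ ^ 2 ^ (n - k) * (1 - ((2 : ℝ) ^ 2 ^ d)⁻¹) ^ S.card := by
    rw [Finset.prod_disjSum]
    have h1 : ∏ w : F2 (n - k), (1 - ((2 : ℝ) ^ (A (Sum.inl w)).card)⁻¹) =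
        (2 : ℝ)⁻¹ ^ 2 ^ (n - k) := by
      simp only [A, Sum.elim_inl, Finset.card_singleton, Finset.prod_const, Finset.card_univ]
      norm_num
    rw [h1]
    gcongr
    refine (Finset.prod_le_prod (fun a _ => ?_) hcardA).trans (Finset.prod_const _).le
    exact sub_nonneg.2 (inv_le_one_of_one_le₀ (one_le_pow₀ one_le_two))
  calc _ ≤ ((Finset.univ.filter fun g : F2 n → Bool =>
          ∀ i ∈ I, ∃ x ∈ A i, g x ≠ p i x).card : ℝ) := by
        rw [← Set.ncard_coe_finset]
        exact_mod_cast Set.ncard_le_ncard hsub (Finset.finite_toSet _)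
    _ ≤ 2 ^ 2 ^ n * ∏ i ∈ I, (1 - ((2 : ℝ) ^ (A i).card)⁻¹) := by
        simpa using card_avoiding_disjoint_blocks_le A p I hA
    _ ≤ 2 ^ 2 ^ n * ((2 : ℝ)⁻¹ ^ 2 ^ (n - k) *
          (2 : ℝ) ^ (-((2 : ℝ) ^ n * (((2 : ℝ) ^ 2 ^ d)⁻¹ * ((4 : ℝ) ^ d)⁻¹)))) := by
        gcongr
        refine hprod.trans ?_
        gcongr
        exact one_sub_inv_pow_le_two_rpow hdn hS
    _ = _ := by
        have h1 : ((2 : ℝ) ^ (2 ^ n : ℕ)) = (2 : ℝ) ^ ((2 : ℝ) ^ n) := by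
          rw [← Real.rpow_natCast]
          push_cast
          rfl
        have h2 : ((2 : ℝ)⁻¹ ^ (2 ^ (n - k) : ℕ)) = (2 : ℝ) ^ (-((2 : ℝ) ^ n * ((2 : ℝ) ^ k)⁻¹)) := by
          rw [← pow_sub₀ _ two_ne_zero (hkd.trans hdn), Real.rpow_neg two_pos.le, inv_pow,
            ← Real.rpow_natCast]
          push_cast
          rfl
        rw [h1, h2, ← Real.rpow_add two_pos, ← Real.rpow_add two_pos]
        ring_nf
end

section
/- For every k ≥ 1, every finite collection 𝒜 of k-affine patterns, and every integer n₀, there exists a k-affine pattern B with dim(B) ≥ n₀ such that for every A ∈ 𝒜, every injective linear map φ⋆ : A⁻¹(⋆) → B⁻¹(⋆) extends to an A-instance φ in B. -/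
open Function Filter Asymptotics

open Module (finrank finrank_fin_fun finrank_pi_fintype finrank_eq_rank)

/-- Number of colorings that miss the target `h` on every one of the disjoint blocks `e (j, ·)`. -/
lemma card_avoiding {P J S : Type*} [Finite P] [Finite J] [Finite S]
    (e : J × S → P) (he : Injective e) (h : S → Bool) :
    (Nat.card {g : P → Bool // ∀ j, ∃ s, g (e (j, s)) ≠ h s} : ℝ) ≤
      2 ^ Nat.card P * (1 - (1 / 2) ^ Nat.card S) ^ Nat.card J := by
  classical
  have := Fintype.ofFinite P
  have := Fintype.ofFinite J
  have := Fintype.ofFinite S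
  let F : {g : P → Bool // ∀ j, ∃ s, g (e (j, s)) ≠ h s} →
      (J → {u : S → Bool // u ≠ h}) × ({p // p ∉ Set.range e} → Bool) := fun g =>
    (fun j => ⟨fun s => g.1 (e (j, s)), fun hu =>
      (g.2 j).elim fun s hs => hs (congrFun hu s)⟩, fun p => g.1 p)
  have hF : Injective F := by
    intro g g' hg
    ext p
    by_cases hp : p ∈ Set.range e
    · obtain ⟨⟨j, s⟩, rfl⟩ := hp
      exact congrFun (congrArg Subtype.val (congrFun (congrArg Prod.fst hg) j)) s
    · exact congrFun (congrArg Prod.snd hg) ⟨p, hp⟩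
  have hle := Nat.card_le_card_of_injective F hF
  have hr : Fintype.card {p // p ∉ Set.range e} + Fintype.card J * Fintype.card S =
      Fintype.card P := by
    have h1 : Fintype.card {p // p ∈ Set.range e} = Fintype.card J * Fintype.card S := by
      rw [← Fintype.card_prod]
      exact Set.card_range_of_injective he
    have h2 := Fintype.card_subtype_compl (fun p => p ∈ Set.range e)
    have h3 := Fintype.card_subtype_le (fun p => p ∈ Set.range e)
    omega
  have hcard : Nat.card ((J → {u : S → Bool // u ≠ h}) × ({p // p ∉ Set.range e} → Bool)) =
      (2 ^ Fintype.card S - 1) ^ Fintype.card J * 2 ^ Fintype.card {p // p ∉ Set.range e} := by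
    simp [Nat.card_eq_fintype_card, Fintype.card_subtype_compl]
  rw [hcard] at hle
  simp only [Nat.card_eq_fintype_card] at hle ⊢
  rw [← hr]
  refine (Nat.cast_le.mpr hle).trans (le_of_eq ?_)
  rw [Nat.cast_mul, Nat.cast_pow, Nat.cast_sub Nat.one_le_two_pow]
  have h2 : ((2 : ℝ) ^ Fintype.card S - 1) =
      2 ^ Fintype.card S * (1 - (1 / 2) ^ Fintype.card S) := by
    rw [mul_sub, ← mul_pow]; norm_num
  push_cast
  rw [h2, mul_pow, ← pow_mul, pow_add, mul_comm (Fintype.card J)]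
  ring

/-- Union bound: some coloring realizes, for every task `i`, the target `h i` on one of its
disjoint blocks `e i (j, ·)`. -/
lemma exists_bool_coloring {I P J : Type*} [Finite I] [Finite P] [Finite J]
    (S : I → Type*) [∀ i, Finite (S i)] (e : ∀ i, J × S i → P) (he : ∀ i, Injective (e i))
    (h : ∀ i, S i → Bool) (M : ℕ) (hM : ∀ i, Nat.card (S i) ≤ M)
    (hlt : (Nat.card I : ℝ) * (1 - (1 / 2) ^ M) ^ Nat.card J < 1) :
    ∃ g : P → Bool, ∀ i, ∃ j, ∀ s, g (e i (j, s)) = h i s := by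
  classical
  by_contra! hbad
  have := Fintype.ofFinite I
  let F : (P → Bool) → Σ i, {g : P → Bool // ∀ j, ∃ s, g (e i (j, s)) ≠ h i s} :=
    fun g => ⟨(hbad g).choose, g, (hbad g).choose_spec⟩
  have hF : Injective F := LeftInverse.injective (g := fun x => x.2.1) fun g => rfl
  have hle := Nat.card_le_card_of_injective F hF
  rw [Nat.card_sigma, Nat.card_fun, Nat.card_eq_fintype_card, Fintype.card_bool] at hle
  have hle' : (2 : ℝ) ^ Nat.card P ≤
      ∑ i, (Nat.card {g : P → Bool // ∀ j, ∃ s, g (e i (j, s)) ≠ h i s} : ℝ) := by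
    exact_mod_cast hle
  have hsum : ∑ i, (Nat.card {g : P → Bool // ∀ j, ∃ s, g (e i (j, s)) ≠ h i s} : ℝ) ≤
      ∑ _i : I, (2 : ℝ) ^ Nat.card P * (1 - (1 / 2) ^ M) ^ Nat.card J := by
    refine Finset.sum_le_sum fun i _ => (card_avoiding (e i) (he i) (h i)).trans ?_
    gcongr ?_ * ?_ ^ _
    · exact sub_nonneg.2 (pow_le_one₀ (by norm_num) (by norm_num))
    · exact sub_le_sub_left (pow_le_pow_of_le_one (by norm_num) (by norm_num) (hM i)) _
  rw [Finset.sum_const, Finset.card_univ, nsmul_eq_mul, ← Nat.card_eq_fintype_card] at hsum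
  have hpos : (0 : ℝ) < 2 ^ Nat.card P := by positivity
  nlinarith

/-- An injective map from `W` into `ker π` has a family of injective extensions, indexed by `T`,
whose values off `W` are pairwise distinct. -/
lemma exists_disjoint_extensions_s9 {K X V T : Type*} [Field K] [AddCommGroup X] [Module K X]
    [AddCommGroup V] [Module K V] [AddCommGroup T] [Module K T] [FiniteDimensional K X]
    [FiniteDimensional K V] [FiniteDimensional K T] {k : ℕ} (W : Submodule K X)
    (hW : finrank K W + k = finrank K X) (π : V →ₗ[K] Fin k → K) (hπ : Surjective π)
    (hdim : finrank K W + k * finrank K T ≤ finrank K π.ker)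
    (ψ : W →ₗ[K] V) (hψ : Injective ψ) (hψπ : ∀ u, π (ψ u) = 0) :
    ∃ φ : T → X →ₗ[K] V, (∀ j, Injective (φ j)) ∧ (∀ j (u : W), φ j u = ψ u) ∧
      (∀ j x, π (φ j x) = 0 → x ∈ W) ∧
      ∀ j j' x x', x ∉ W → φ j x = φ j' x' → j = j' ∧ x = x' := by
  obtain ⟨c, hc⟩ : ∃ c : X →ₗ[K] Fin k → K, ∀ x, c x = 0 ↔ x ∈ W := by
    have hq : finrank K (X ⧸ W) = finrank K (Fin k → K) := by
      have := W.finrank_quotient_add_finrank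
      rw [finrank_fin_fun]; omega
    refine ⟨(LinearEquiv.ofFinrankEq _ _ hq).toLinearMap ∘ₗ W.mkQ, fun x => by simp⟩
  obtain ⟨p, hp⟩ := LinearMap.exists_leftInverse_of_injective W.subtype W.ker_subtype
  replace hp : ∀ u : W, p u = u := fun u => LinearMap.congr_fun hp u
  obtain ⟨σ, hσ⟩ := π.exists_rightInverse_of_surjective (LinearMap.range_eq_top.2 hπ)
  replace hσ : ∀ y, π (σ y) = y := fun y => LinearMap.congr_fun hσ y
  obtain ⟨ι, hι, hιπ, hdisj⟩ : ∃ ι : (Fin k → T) →ₗ[K] V, Injective ι ∧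
      (∀ y, π (ι y) = 0) ∧ ∀ u y, ψ u + ι y = 0 → u = 0 ∧ y = 0 := by
    let ψ' : W →ₗ[K] π.ker := ψ.codRestrict π.ker hψπ
    have hψ' : Injective ψ' := fun a b hab => hψ (congrArg Subtype.val hab)
    obtain ⟨C, hC⟩ := Submodule.exists_isCompl ψ'.range
    have h1 := Submodule.finrank_add_eq_of_isCompl hC
    rw [LinearMap.finrank_range_of_inj hψ'] at h1
    obtain ⟨f, hf⟩ : ∃ f : (Fin k → T) →ₗ[K] C, Injective f := by
      refine lift_rank_le_iff_exists_linearMap.1 ?_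
      rw [← finrank_eq_rank, ← finrank_eq_rank, Cardinal.lift_natCast, Cardinal.lift_natCast,
        Nat.cast_le, finrank_pi_fintype]
      simp
      omega
    refine ⟨π.ker.subtype ∘ₗ C.subtype ∘ₗ f, ?_, fun y => (f y).1.2, fun u y huy => ?_⟩
    · exact Subtype.val_injective.comp (Subtype.val_injective.comp hf)
    · have h2 : ψ' u + (f y : π.ker) = 0 := Subtype.ext huy
      have h3 : (f y : π.ker) = 0 := by
        refine Submodule.disjoint_def.1 hC.disjoint _ ⟨-u, ?_⟩ (f y).2
        rw [map_neg, neg_eq_iff_add_eq_zero, h2]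
      rw [h3, add_zero] at h2
      exact ⟨(map_eq_zero_iff _ hψ').1 h2,
        (map_eq_zero_iff _ hf).1 (Subtype.ext h3)⟩
  let τ : T → (Fin k → K) →ₗ[K] (Fin k → T) := fun j =>
    LinearMap.pi fun i => (LinearMap.toSpanSingleton K T j) ∘ₗ LinearMap.proj i
  have hτ : ∀ j y i, τ j y i = y i • j := fun j y i => rfl
  have hφπ : ∀ j x, π ((ψ ∘ₗ p + σ ∘ₗ c + ι ∘ₗ τ j ∘ₗ c) x) = c x := fun j x => by
    simp [hψπ, hσ, hιπ]
  have hφW : ∀ j (u : W), (ψ ∘ₗ p + σ ∘ₗ c + ι ∘ₗ τ j ∘ₗ c) u = ψ u := fun j u => by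
    simp [(hc u).2 u.2, hp]
  refine ⟨fun j => ψ ∘ₗ p + σ ∘ₗ c + ι ∘ₗ τ j ∘ₗ c, fun j => ?_, hφW, fun j x hx => ?_,
    fun j j' x x' hx hxx => ?_⟩
  · rw [injective_iff_map_eq_zero]
    intro x hx
    have hxW : x ∈ W := (hc x).1 (by rw [← hφπ j x, hx, map_zero])
    have := hφW j ⟨x, hxW⟩
    rw [hx, eq_comm, map_eq_zero_iff _ hψ] at this
    exact congrArg Subtype.val this
  · rwa [hφπ, hc] at hx
  · have hcc : c x = c x' := by rw [← hφπ j x, hxx, hφπ]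
    have h0 : ψ (p (x - x')) + ι (τ j (c x) - τ j' (c x)) = 0 := by
      simp only [LinearMap.add_apply, LinearMap.comp_apply, ← hcc] at hxx
      simp only [map_sub]
      rw [← sub_eq_zero] at hxx
      rw [← hxx]
      abel
    obtain ⟨h1, h2⟩ := hdisj _ _ h0
    have hsub : x - x' ∈ W := by rw [← hc, map_sub, hcc, sub_self]
    have h3 := hp ⟨x - x', hsub⟩
    rw [h1] at h3
    refine ⟨?_, sub_eq_zero.1 (congrArg Subtype.val h3).symm⟩
    obtain ⟨i, hi⟩ : ∃ i, c x i ≠ 0 := Function.ne_iff.1 (mt (hc x).1 hx)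
    have h4 := congrFun h2 i
    rw [Pi.sub_apply, hτ, hτ, ← smul_sub, Pi.zero_apply, smul_eq_zero] at h4
    exact sub_eq_zero.1 (h4.resolve_left hi)

lemma exists_two_pow_bound (a b c M : ℕ) : ∃ t : ℕ,
    (a : ℝ) * (2 ^ (b + c * t)) ^ M * (1 - (1 / 2) ^ M) ^ 2 ^ t < 1 := by
  have hq : |1 - (1 / 2 : ℝ) ^ M| < 1 := by
    have h0 : (0 : ℝ) < (1 / 2) ^ M := by positivity
    have h1 : (1 / 2 : ℝ) ^ M ≤ 1 := pow_le_one₀ (by norm_num) (by norm_num)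
    rw [abs_lt]; constructor <;> linarith
  have h := ((tendsto_pow_const_mul_const_pow_of_abs_lt_one (c * M) hq).comp
    (tendsto_pow_atTop_atTop_of_one_lt (one_lt_two : 1 < 2))).const_mul
    ((a : ℝ) * 2 ^ (b * M))
  rw [mul_zero] at h
  obtain ⟨t, ht⟩ := (h.eventually (gt_mem_nhds one_pos)).exists
  refine ⟨t, lt_of_eq_of_lt ?_ ht⟩
  simp only [comp_apply]
  push_cast
  ring

/-- Corollary 3.3: for every `k ≥ 1`, every finite collection `𝒜` of
`k`-affine patterns and every integer `n₀`, there exists a `k`-affine pattern `B` with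
`dim B ≥ n₀` such that for every `A ∈ 𝒜`, every injective linear map
`φ⋆ : A⁻¹(⋆) → B⁻¹(⋆)` extends to an `A`-instance `φ` in `B`. -/
theorem extendable_affine_pattern (k : ℕ) (hk : 1 ≤ k)
    (𝒜 : Set BinPattern) (hfin : 𝒜.Finite) (haff : ∀ A ∈ 𝒜, IsKAffine k A)
    (n₀ : ℕ) :
    ∃ B : BinPattern, IsKAffine k B ∧ n₀ ≤ B.dim ∧
      ∀ A ∈ 𝒜,
        ∀ (WA : Submodule (ZMod 2) (F2 A.dim)) (WB : Submodule (ZMod 2) (F2 B.dim)),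
        (∀ x : F2 A.dim, A.val x = none ↔ x ∈ WA) →
        (∀ x : F2 B.dim, B.val x = none ↔ x ∈ WB) →
        ∀ φs : WA →ₗ[ZMod 2] F2 B.dim, Injective φs → (∀ u : WA, φs u ∈ WB) →
          ∃ φ : F2 A.dim →ₗ[ZMod 2] F2 B.dim, Injective φ ∧
            (∀ (x : F2 A.dim) (b : Bool), A.val x = some b → B.val (φ x) = some b) ∧
            ∀ u : WA, φ u = φs u := by
  classical
  obtain ⟨D, hD⟩ := (hfin.image BinPattern.dim).bddAbove
  replace hD : ∀ A ∈ 𝒜, A.dim ≤ D := fun A hA => hD ⟨A, hA, rfl⟩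
  have := hfin.to_subtype
  have := Fintype.ofFinite 𝒜
  obtain ⟨t, ht⟩ := exists_two_pow_bound (Nat.card 𝒜) (k + (D + n₀)) k (2 ^ D)
  choose W hWk hW using fun A : 𝒜 => haff A A.2
  set m := D + n₀ + k * t with hm
  let π : F2 (k + m) →ₗ[ZMod 2] (Fin k → ZMod 2) :=
    LinearMap.funLeft (ZMod 2) (ZMod 2) (Fin.castAdd m)
  have hπ : Surjective π :=
    LinearMap.funLeft_surjective_of_injective _ _ _ (Fin.castAdd_injective k m)
  have hker : finrank (ZMod 2) π.ker = m := by
    have h1 := π.finrank_range_add_finrank_ker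
    rw [LinearMap.range_eq_top.2 hπ, finrank_top] at h1
    simpa using h1
  have hfinI : ∀ A : 𝒜,
      Finite {ψ : W A →ₗ[ZMod 2] F2 (k + m) // Injective ψ ∧ ∀ u, π (ψ u) = 0} := fun A =>
    Finite.of_injective (fun ψ => (ψ.1 : W A → F2 (k + m)))
      (DFunLike.coe_injective.comp Subtype.val_injective)
  let I := Σ A : 𝒜, {ψ : W A →ₗ[ZMod 2] F2 (k + m) // Injective ψ ∧ ∀ u, π (ψ u) = 0}
  have hcardF2 : ∀ n, Nat.card (F2 n) = 2 ^ n := fun n => by simp [F2]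
  have hcardX : ∀ A : 𝒜, Nat.card (F2 A.1.dim) ≤ 2 ^ D := fun A => by
    rw [hcardF2]; exact Nat.pow_le_pow_right two_pos (hD A A.2)
  have hcardI : Nat.card I ≤ Nat.card 𝒜 * (2 ^ (k + m)) ^ 2 ^ D := by
    rw [Nat.card_sigma, Nat.card_eq_fintype_card (α := 𝒜), ← smul_eq_mul, ← Finset.card_univ]
    refine Finset.sum_le_card_nsmul _ _ _ fun A _ => ?_
    have h1 := Nat.card_le_card_of_injective
      (fun ψ : {ψ : W A →ₗ[ZMod 2] F2 (k + m) // Injective ψ ∧ ∀ u, π (ψ u) = 0} =>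
        (ψ.1 : W A → F2 (k + m))) (DFunLike.coe_injective.comp Subtype.val_injective)
    rw [Nat.card_fun, hcardF2] at h1
    refine h1.trans (Nat.pow_le_pow_right (by positivity) ?_)
    exact (Nat.card_le_card_of_injective _ Subtype.val_injective).trans (hcardX A)
  have hWD : ∀ A : 𝒜, finrank (ZMod 2) (W A) + k * finrank (ZMod 2) (F2 t) ≤
      finrank (ZMod 2) π.ker := fun A => by
    have h1 := hWk A
    have h2 := hD A A.2
    rw [hker, finrank_fin_fun]
    omega
  choose φ hφinj hφext hφπ hφdisj using fun i : I =>
    exists_disjoint_extensions_s9 (T := F2 t) (W i.1) (by rw [hWk, finrank_fin_fun]) π hπ (hWD i.1)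
      i.2.1 i.2.2.1 i.2.2.2
  obtain ⟨g, hg⟩ := exists_bool_coloring (J := F2 t)
    (fun i : I => {x : F2 i.1.1.dim // x ∉ W i.1}) (fun i p => φ i p.1 p.2.1)
    (fun i p p' hp => by
      obtain ⟨h1, h2⟩ := hφdisj i _ _ _ _ p.2.2 hp
      exact Prod.ext h1 (Subtype.ext h2))
    (fun i x => (i.1.1.val x.1).getD false) (2 ^ D)
    (fun i => (Nat.card_le_card_of_injective _ Subtype.val_injective).trans (hcardX i.1))
    (by
      rw [hcardF2]
      refine lt_of_le_of_lt ?_ ht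
      rw [add_assoc k, ← hm]
      refine mul_le_mul_of_nonneg_right (by exact_mod_cast hcardI) (pow_nonneg ?_ _)
      exact sub_nonneg.2 (pow_le_one₀ (by norm_num) (by norm_num)))
  let B : BinPattern := ⟨k + m, fun x => if π x = 0 then none else some (g x), by simp⟩
  have hB : ∀ x, B.val x = none ↔ π x = 0 := fun x => by
    by_cases h : π x = 0 <;> simp [B, h]
  refine ⟨B, ⟨π.ker, by rw [hker, add_comm], hB⟩, ?_, ?_⟩
  · change n₀ ≤ k + m
    omega
  intro A hA WA WB hWA hWB ψ hψ hψW
  obtain rfl : WA = W ⟨A, hA⟩ := by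
    ext x
    rw [← hWA, ← hW]
  let i : I := ⟨⟨A, hA⟩, ψ, hψ, fun u => (hB _).1 ((hWB _).2 (hψW u))⟩
  obtain ⟨j, hj⟩ := hg i
  refine ⟨φ i j, hφinj i j, fun x b hxb => ?_, hφext i j⟩
  have hx : x ∉ W ⟨A, hA⟩ := by
    rw [← hWA, hxb]
    simp
  have h1 := hj ⟨x, hx⟩
  have h2 : π (φ i j x) ≠ 0 := mt (hφπ i j x) hx
  change (if π (φ i j x) = 0 then none else some (g (φ i j x))) = some b
  rw [if_neg h2]
  simp only [i] at h1 ⊢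
  rw [h1, hxb, Option.getD_some]
end

section
/- Let k ≥ 1 be an integer and let 𝒫 be a hereditary matroid property. Then neither ℳ(k,0) ⊆ 𝒫 nor ℳ(k,1) ⊆ 𝒫 holds (equivalently, χ_c(𝒫) < k when 𝒫 is non-trivial) if and only if there exists a k-affine pattern B such that every matroid in 𝒫 is B-free. -/
open Function Filter Asymptotics

/-- The set of nonzero vectors of some `d`-dimensional subspace of `𝔽₂ʳ` has constant colour `b`
under `c`. -/
def HasMonoSubspace {r : ℕ} (c : F2 r → Bool) (d : ℕ) (b : Bool) : Prop :=
  ∃ g : F2 d →ₗ[ZMod 2] F2 r, Injective g ∧ ∀ x, x ≠ 0 → c (g x) = b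

theorem hasMonoSubspace_zero {r : ℕ} (c : F2 r → Bool) (b : Bool) : HasMonoSubspace c 0 b :=
  ⟨0, injective_of_subsingleton _, fun x hx => (hx (Subsingleton.elim x 0)).elim⟩

theorem HasMonoSubspace.of_comp {r s d : ℕ} {c : F2 s → Bool} {b : Bool}
    (j : F2 r →ₗ[ZMod 2] F2 s) (hj : Injective j) (h : HasMonoSubspace (c ∘ j) d b) :
    HasMonoSubspace c d b := by
  obtain ⟨g, hg, hc⟩ := h
  exact ⟨j ∘ₗ g, hj.comp hg, hc⟩

theorem HasMonoSubspace.succ {r s d : ℕ} {c : F2 s → Bool} {b : Bool}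
    (j : F2 r →ₗ[ZMod 2] F2 s) (hj : Injective j) (v : F2 s) (hv : ∀ x, j x ≠ v)
    (hc : ∀ x, c (v + j x) = b) (h : HasMonoSubspace (c ∘ j) d b) :
    HasMonoSubspace c (d + 1) b := by
  obtain ⟨g, hg, hgc⟩ := h
  let tail : F2 (d + 1) →ₗ[ZMod 2] F2 d := LinearMap.funLeft _ _ Fin.succ
  let G : F2 (d + 1) →ₗ[ZMod 2] F2 s :=
    (LinearMap.proj 0).smulRight v + (j ∘ₗ g) ∘ₗ tail
  have hG : ∀ x, G x = x 0 • v + j (g (tail x)) := fun x => rfl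
  have h01 : ∀ t : ZMod 2, t = 0 ∨ t = 1 := by decide
  have tail_ne : ∀ x, x ≠ 0 → x 0 = 0 → tail x ≠ 0 := by
    intro x hx h0 ht
    apply hx
    ext i
    refine Fin.cases h0 (fun i => ?_) i
    exact congrFun ht i
  refine ⟨G, ?_, ?_⟩
  · rw [injective_iff_map_eq_zero]
    intro x hx
    by_contra hne
    rw [hG] at hx
    rcases h01 (x 0) with h0 | h0
    · rw [h0, zero_smul, zero_add] at hx
      have : g (tail x) = 0 := hj (by rw [hx, map_zero])
      exact tail_ne x hne h0 (hg (by rw [this, map_zero]))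
    · rw [h0, one_smul] at hx
      apply hv (-(g (tail x)))
      rw [map_neg]
      exact (eq_neg_of_add_eq_zero_left hx).symm
  · intro x hx
    rw [hG]
    rcases h01 (x 0) with h0 | h0
    · rw [h0, zero_smul, zero_add]
      exact hgc _ (tail_ne x hx h0)
    · rw [h0, one_smul]
      exact hc _

/-- In every 2-colouring of `𝔽₂ʳ` with `r` large there is a monochromatic `m`-dimensional affine
subspace avoiding the origin. -/
theorem exists_mono_affine (m : ℕ) : ∃ r, ∀ c : F2 r → Bool,
    ∃ (j : F2 m →ₗ[ZMod 2] F2 r) (v : F2 r) (b : Bool),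
      Injective j ∧ (∀ x, j x ≠ v) ∧ ∀ x, c (v + j x) = b := by
  obtain ⟨n, hn⟩ := Combinatorics.Subspace.exists_mono_in_high_dimension_fin (ZMod 2) Bool (Fin m)
  refine ⟨n + 1, fun c => ?_⟩
  obtain ⟨l, b, hb⟩ := hn fun x => c (Fin.cons 1 x)
  let j : F2 m →ₗ[ZMod 2] F2 (n + 1) := LinearMap.pi (Fin.cons 0 fun i =>
    (l.idxFun i).elim (fun _ => 0) fun e => LinearMap.proj e)
  have hj0 : ∀ x, j x 0 = 0 := fun x => rfl
  have hjs : ∀ x i, j x (Fin.succ i) = (l.idxFun i).elim (fun _ => 0) fun e => x e := by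
    intro x i
    simp only [j, LinearMap.pi_apply, Fin.cons_succ]
    cases l.idxFun i <;> rfl
  refine ⟨j, Fin.cons 1 (l 0), b, ?_, ?_, ?_⟩
  · intro x y hxy
    ext e
    obtain ⟨i, hi⟩ := l.proper e
    simpa [hjs, hi] using congrFun hxy i.succ
  · intro x hx
    have := congrFun hx 0
    rw [hj0, Fin.cons_zero] at this
    exact zero_ne_one this
  · intro x
    rw [← hb x]
    congr 1
    ext i
    refine Fin.cases ?_ (fun i => ?_) i
    · simp [hj0]
    · simp only [Pi.add_apply, Fin.cons_succ, hjs, Combinatorics.Subspace.coe_apply]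
      cases l.idxFun i <;> simp

/-- Ramsey's theorem for the points of binary projective spaces, two colours. -/
theorem exists_hasMonoSubspace (a b : ℕ) : ∃ r, ∀ c : F2 r → Bool,
    HasMonoSubspace c a false ∨ HasMonoSubspace c b true := by
  induction a generalizing b with
  | zero => exact ⟨0, fun c => Or.inl (hasMonoSubspace_zero c _)⟩
  | succ a iha =>
    induction b with
    | zero => exact ⟨0, fun c => Or.inr (hasMonoSubspace_zero c _)⟩
    | succ b ihb =>
      obtain ⟨r₁, h₁⟩ := iha (b + 1)
      obtain ⟨r₂, h₂⟩ := ihb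
      obtain ⟨r, hr⟩ := exists_mono_affine (max r₁ r₂)
      refine ⟨r, fun c => ?_⟩
      obtain ⟨j, v, β, hj, hv, hc⟩ := hr c
      cases β with
      | false =>
        obtain ⟨p, hp⟩ := (finrank_le_iff_exists_linearMap (R := ZMod 2)
          (M := F2 r₁) (M' := F2 (max r₁ r₂))).1 (by simp)
        rcases h₁ ((c ∘ j) ∘ p) with h | h
        · exact Or.inl ((h.of_comp p hp).succ j hj v hv hc)
        · exact Or.inr ((h.of_comp p hp).of_comp j hj)
      | true =>
        obtain ⟨p, hp⟩ := (finrank_le_iff_exists_linearMap (R := ZMod 2)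
          (M := F2 r₂) (M' := F2 (max r₁ r₂))).1 (by simp)
        rcases h₂ ((c ∘ j) ∘ p) with h | h
        · exact Or.inl ((h.of_comp p hp).of_comp j hj)
        · exact Or.inr ((h.of_comp p hp).succ j hj v hv hc)

/-- Filling the stars of a `k`-affine pattern with the constant `b` gives a matroid in `ℳ(k, b)`
that contains the pattern. -/
theorem IsKAffine.exists_mem_mkOne_patInstance {k : ℕ} {B : BinPattern} (hB : IsKAffine k B)
    (b : Bool) : ∃ M ∈ MkOne k b, PatInstance B M := by
  classical
  obtain ⟨W, hW, hval⟩ := hB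
  let M : BinMatroid :=
    { dim := B.dim
      val := fun x => if x = 0 then false else (B.val x).getD b
      val0 := if_pos rfl }
  let e : F2 (Module.finrank (ZMod 2) W) ≃ₗ[ZMod 2] W :=
    (Module.finBasis (ZMod 2) W).equivFun.symm
  refine ⟨M, ⟨_, W.subtype ∘ₗ e.toLinearMap, hW.ge,
    W.injective_subtype.comp e.injective, fun x hx => ?_⟩, LinearMap.id, injective_id, ?_⟩
  · have hne : (e x : F2 B.dim) ≠ 0 := by simpa using hx
    change (if (e x : F2 B.dim) = 0 then false else (B.val (e x)).getD b) = b
    rw [if_neg hne, (hval _).2 (e x).2, Option.getD_none]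
  · intro x β hx
    have hne : x ≠ 0 := by
      rintro rfl
      simp [B.val0] at hx
    change (if x = 0 then false else (B.val x).getD b) = β
    rw [if_neg hne, hx, Option.getD_some]

theorem exists_linearMap_of_mem_mkOne {k : ℕ} {b : Bool} {M : BinMatroid} (hM : M ∈ MkOne k b) :
    ∃ π : F2 M.dim →ₗ[ZMod 2] F2 k, ∀ x, x ≠ 0 → π x = 0 → M.val x = b := by
  obtain ⟨m, φ, hm, hφ, hval⟩ := hM
  have h1 := (LinearMap.range φ).finrank_quotient_add_finrank
  rw [LinearMap.finrank_range_of_inj hφ] at h1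
  simp only [Module.finrank_fin_fun] at h1
  obtain ⟨f, hf⟩ := (finrank_le_iff_exists_linearMap (R := ZMod 2)
    (M := F2 M.dim ⧸ LinearMap.range φ) (M' := F2 k)).1 (by
      rw [Module.finrank_fin_fun]; omega)
  refine ⟨f ∘ₗ (LinearMap.range φ).mkQ, fun x hx hx0 => ?_⟩
  have : (LinearMap.range φ).mkQ x = 0 := hf (by rw [map_zero]; exact hx0)
  rw [Submodule.mkQ_apply, Submodule.Quotient.mk_eq_zero] at this
  obtain ⟨y, rfl⟩ := this
  exact hval y (by rintro rfl; exact hx (map_zero φ))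

/-- A `k`-affine pattern each of whose fillings contains `M false` or `M true`. -/
theorem exists_isKAffine_forall_isRestriction {k : ℕ} (M : Bool → BinMatroid)
    (hM : ∀ b, M b ∈ MkOne k b) :
    ∃ B, IsKAffine k B ∧ ∀ N, PatInstance B N → ∃ b, IsRestriction (M b) N := by
  classical
  choose π hπ using fun b => exists_linearMap_of_mem_mkOne (hM b)
  obtain ⟨r, hr⟩ := exists_hasMonoSubspace (M false).dim (M true).dim
  let I := Σ b : Bool, {g : F2 (M b).dim →ₗ[ZMod 2] F2 r // Injective g}
  have : ∀ d, Finite (F2 d →ₗ[ZMod 2] F2 r) := fun d =>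
    Finite.of_injective _ (DFunLike.coe_injective (F := F2 d →ₗ[ZMod 2] F2 r))
  have : Finite I := inferInstance
  have : Fintype I := Fintype.ofFinite I
  let V := F2 k × F2 r × (I → F2 k)
  let e : F2 (Module.finrank (ZMod 2) V) ≃ₗ[ZMod 2] V :=
    (Module.finBasis (ZMod 2) V).equivFun.symm
  let ψ : ∀ t : I, F2 (M t.1).dim →ₗ[ZMod 2] V := fun t =>
    (π t.1).prod (t.2.1.prod (LinearMap.single (ZMod 2) (fun _ : I => F2 k) t ∘ₗ π t.1))
  have hψ : ∀ t x, ψ t x = (π t.1 x, t.2.1 x, Pi.single t (π t.1 x)) := fun t x => rfl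
  have hψinj : ∀ t, Injective (ψ t) := fun t x y hxy => by
    rw [hψ, hψ, Prod.mk.injEq, Prod.mk.injEq] at hxy
    exact t.2.2 hxy.2.1
  let F : V → Bool := fun v => decide (∃ t x, ψ t x = v ∧ (M t.1).val x = true)
  have hF : ∀ t x, π t.1 x ≠ 0 → F (ψ t x) = (M t.1).val x := by
    intro t x hx
    have key : (∃ t' x', ψ t' x' = ψ t x ∧ (M t'.1).val x' = true) ↔ (M t.1).val x = true := by
      constructor
      · rintro ⟨t', x', h, hv⟩
        have h' := h
        rw [hψ, hψ, Prod.mk.injEq, Prod.mk.injEq] at h'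
        obtain ⟨h1, -, h3⟩ := h'
        have ht : t = t' := by
          by_contra hne
          have := congrFun h3 t
          rw [Pi.single_eq_same, Pi.single_eq_of_ne hne] at this
          exact hx this.symm
        subst ht
        rwa [← hψinj _ h]
      · exact fun h => ⟨t, x, rfl, h⟩
    simp only [F, key, Bool.decide_eq_true]
  let B : BinPattern :=
    { dim := Module.finrank (ZMod 2) V
      val := fun x => if (e x).1 = 0 then none else some (F (e x))
      val0 := if_pos (by simp) }
  have hBval : ∀ x : F2 (Module.finrank (ZMod 2) V),
      B.val x = if (e x).1 = 0 then none else some (F (e x)) := fun _ => rfl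
  let q : F2 (Module.finrank (ZMod 2) V) →ₗ[ZMod 2] F2 k :=
    LinearMap.fst (ZMod 2) (F2 k) (F2 r × (I → F2 k)) ∘ₗ e.toLinearMap
  refine ⟨B, ⟨LinearMap.ker q, ?_, fun x => ?_⟩, ?_⟩
  · have hq : LinearMap.range q = ⊤ :=
      LinearMap.range_eq_top.2 (Prod.fst_surjective.comp e.surjective)
    have := q.finrank_range_add_finrank_ker
    rw [hq, finrank_top, Module.finrank_fin_fun, Module.finrank_fin_fun] at this
    rw [add_comm]
    exact this
  · rw [LinearMap.mem_ker]
    change B.val x = none ↔ (e x).1 = 0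
    rw [hBval]
    split_ifs with h <;> simp [h]
  · rintro N ⟨φ, hφ, hN⟩
    let θ : V →ₗ[ZMod 2] F2 N.dim := φ ∘ₗ e.symm.toLinearMap
    have hθ : Injective θ := hφ.comp e.symm.injective
    have hθN : ∀ v, v.1 ≠ 0 → N.val (θ v) = F v := by
      intro v hv
      refine hN (e.symm v) (F v) ?_
      rw [hBval, e.apply_symm_apply, if_neg hv]
    have main : ∀ b, HasMonoSubspace (fun w => N.val (θ (0, w, 0))) (M b).dim b →
        IsRestriction (M b) N := by
      rintro b ⟨g, hg, hgc⟩
      let t : I := ⟨b, g, hg⟩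
      refine ⟨θ ∘ₗ ψ t, hθ.comp (hψinj t), fun x hx => ?_⟩
      change (M b).val x = N.val (θ (ψ t x))
      by_cases h0 : π b x = 0
      · have : ψ t x = (0, g x, 0) := by
          rw [hψ]
          change (π b x, g x, (Pi.single t (π b x) : I → F2 k)) = _
          rw [h0, Pi.single_zero]
        rw [this, hπ b x hx h0]
        exact (hgc x hx).symm
      · rw [hθN _ h0, hF t x h0]
    rcases hr fun w => N.val (θ (0, w, 0)) with h | h
    · exact ⟨false, main _ h⟩
    · exact ⟨true, main _ h⟩

/-- Corollary 3.6: for `k ≥ 1` and a hereditary matroid property `P`,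
neither `ℳ(k,0) ⊆ P` nor `ℳ(k,1) ⊆ P` (i.e. `χ_c(P) < k` when `P` is non-trivial)
if and only if there is a `k`-affine pattern `B` such that every matroid in `P` is
`B`-free. -/
theorem critical_number_kaffine (k : ℕ) (hk : 1 ≤ k)
    (P : Set BinMatroid) (hher : IsHereditary P) :
    (¬ MkOne k false ⊆ P ∧ ¬ MkOne k true ⊆ P) ↔
      ∃ B : BinPattern, IsKAffine k B ∧ ∀ M ∈ P, PatFree B M := by
  constructor
  · rintro ⟨h0, h1⟩
    have h : ∀ b, ∃ M ∈ MkOne k b, M ∉ P := by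
      rintro (_ | _)
      · exact Set.not_subset.1 h0
      · exact Set.not_subset.1 h1
    choose M hM hMP using h
    obtain ⟨B, hB, hres⟩ := exists_isKAffine_forall_isRestriction M hM
    refine ⟨B, hB, fun N hN hinst => ?_⟩
    obtain ⟨b, hb⟩ := hres N hinst
    exact hMP b (hher N hN _ hb)
  · rintro ⟨B, hB, hfree⟩
    have h : ∀ b, ¬ MkOne k b ⊆ P := fun b hsub => by
      obtain ⟨M, hM, hinst⟩ := hB.exists_mem_mkOne_patInstance b
      exact hfree M (hsub hM) hinst
    exact ⟨h false, h true⟩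
end
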